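/- arXiv:1801.08931 — 2 statements merged into one kernel-verified Lean document; each statement's English description precedes it below -/
import Mathlib

section
/- (Bonami–Beckner hypercontractivity) For every n ≥ 1, every f : C_n → ℝ, every t ≥ 0 and every q ≥ 1, the operator Q_t satisfies ‖Q_t f‖_q ≤ ‖f‖_p with p = 1 + (q − 1)e^{−2t}, where ‖·‖_r denotes the L^r(μⁿ) norm. -/
/-- Expectation on the discrete cube `{-1,1}ⁿ ≃ (Fin n → Bool)` under the uniform measure. -/
noncomputable def EC {n : ℕ} (g : (Fin n → Bool) → ℝ) : ℝ :=
  (∑ x : Fin n → Bool, g x) / 2 ^ n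

/-- `L^p(μⁿ)`-norm on the discrete cube. -/
noncomputable def normC {n : ℕ} (p : ℝ) (g : (Fin n → Bool) → ℝ) : ℝ :=
  (EC fun x => |g x| ^ p) ^ (1 / p)

/-- The sign `±1` associated with a boolean coordinate. -/
def sgn (b : Bool) : ℝ := if b then 1 else -1

/-- The Bonami–Beckner semigroup:
`Q_t g (x) = ∫ g(y) ∏ᵢ (1 + e^{-t} xᵢ yᵢ) dμⁿ(y)`. -/
noncomputable def Q {n : ℕ} (t : ℝ) (g : (Fin n → Bool) → ℝ) : (Fin n → Bool) → ℝ :=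
  fun x => EC (fun y => g y * ∏ i : Fin n, (1 + Real.exp (-t) * sgn (x i) * sgn (y i)))

open Real in
theorem sinh_mul_le_mul_sinh {θ x : ℝ} (h0 : 0 ≤ θ) (h1 : θ ≤ 1) (hx : 0 ≤ x) :
    sinh (θ * x) ≤ θ * sinh x := by
  have key : MonotoneOn (fun y => θ * sinh y - sinh (θ * y)) (Set.Ici 0) := by
    have hd (y : ℝ) : HasDerivAt (fun y => θ * sinh y - sinh (θ * y))
        (θ * cosh y - cosh (θ * y) * (θ * 1)) y :=
      ((hasDerivAt_sinh y).const_mul θ).sub (((hasDerivAt_id y).const_mul θ).sinh)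
    refine monotoneOn_of_deriv_nonneg (convex_Ici 0)
      (fun y _ => (hd y).continuousAt.continuousWithinAt)
      (fun y _ => (hd y).differentiableAt.differentiableWithinAt) fun y hy => ?_
    rw [interior_Ici, Set.mem_Ioi] at hy
    rw [(hd y).deriv]
    have : cosh (θ * y) ≤ cosh y := by
      rw [cosh_le_cosh, abs_of_pos hy, abs_of_nonneg (by positivity)]
      nlinarith
    nlinarith
  have := key Set.self_mem_Ici hx hx
  simp only [mul_zero, sinh_zero, sub_zero] at this
  linarith

open Real in
theorem sinh_mul_sq_le {θ x : ℝ} (h : |θ| ≤ 1) (hx : 0 ≤ x) :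
    sinh (θ * x) ^ 2 ≤ θ ^ 2 * sinh x ^ 2 := by
  have h1 := sinh_mul_le_mul_sinh (abs_nonneg θ) h hx
  have h2 : sinh (θ * x) ^ 2 = sinh (|θ| * x) ^ 2 := by
    rcases abs_choice θ with h | h <;> rw [h]
    rw [neg_mul, sinh_neg, neg_sq]
  rw [h2, ← sq_abs θ, ← mul_pow]
  exact pow_le_pow_left₀ (sinh_nonneg_iff.2 (by positivity)) h1 2

/-- The Stroock–Varopoulos inequality on the two-point space. -/
theorem two_mul_cosh_sub_one_le {q y : ℝ} (hq : 1 ≤ q) (hy : 0 ≤ y) :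
    2 * (q - 1) * (Real.cosh (q * y) - 1) ≤ q ^ 2 * (Real.sinh y * Real.sinh ((q - 1) * y)) := by
  have hq0 : 0 < q := by linarith
  set w := q * y / 2 with hw
  set v := (q - 2) / q * w with hv
  have hvy : v = (q - 2) * y / 2 := by rw [hv, hw]; field_simp
  have e1 : y = w - v := by rw [hvy, hw]; ring
  have e2 : (q - 1) * y = w + v := by rw [hvy, hw]; ring
  have e3 : q * y = 2 * w := by rw [hw]; ring
  have h := sinh_mul_sq_le (θ := (q - 2) / q) (x := w)
    (by rw [abs_div, abs_of_pos hq0, div_le_one hq0, abs_le]; constructor <;> linarith)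
    (by positivity)
  rw [← hv] at h
  have h' : q ^ 2 * Real.sinh v ^ 2 ≤ (q - 2) ^ 2 * Real.sinh w ^ 2 := by
    calc _ ≤ q ^ 2 * (((q - 2) / q) ^ 2 * Real.sinh w ^ 2) := by gcongr
      _ = _ := by field_simp
  have e4 : Real.sinh y * Real.sinh ((q - 1) * y) = Real.sinh w ^ 2 - Real.sinh v ^ 2 := by
    rw [e2]
    conv_lhs => rw [e1]
    rw [Real.sinh_add, Real.sinh_sub]
    linear_combination Real.sinh w ^ 2 * Real.cosh_sq v - Real.sinh v ^ 2 * Real.cosh_sq w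
  rw [e4, e3, Real.cosh_two_mul, Real.cosh_sq]
  linarith

open Real in
/-- The logarithmic Sobolev inequality on the two-point space. -/
theorem mul_sinh_sub_cosh_mul_log_cosh_le {z : ℝ} (hz : 0 ≤ z) :
    z * sinh z - cosh z * log (cosh z) ≤ cosh z - 1 := by
  have key : MonotoneOn (fun y => log (cosh y) - (1 + y * sinh y) / cosh y) (Set.Ici 0) := by
    have hd (y : ℝ) : HasDerivAt (fun y => log (cosh y) - (1 + y * sinh y) / cosh y)
        (sinh y / cosh y - ((1 * sinh y + y * cosh y) * cosh y - (1 + y * sinh y) * sinh y)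
          / cosh y ^ 2) y :=
      ((hasDerivAt_cosh y).log (cosh_pos y).ne').sub
        ((((hasDerivAt_id y).mul (hasDerivAt_sinh y)).const_add 1).div (hasDerivAt_cosh y)
          (cosh_pos y).ne')
    refine monotoneOn_of_deriv_nonneg (convex_Ici 0)
      (fun y _ => (hd y).continuousAt.continuousWithinAt)
      (fun y _ => (hd y).differentiableAt.differentiableWithinAt) fun y hy => ?_
    rw [interior_Ici, Set.mem_Ioi] at hy
    rw [(hd y).deriv]
    have h1 : y ≤ sinh y := self_le_sinh_iff.2 hy.le
    have h2 := cosh_pos y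
    have : sinh y / cosh y - ((1 * sinh y + y * cosh y) * cosh y - (1 + y * sinh y) * sinh y)
          / cosh y ^ 2 = (sinh y - y) / cosh y ^ 2 := by
      field_simp
      linear_combination (-y) * cosh_sq y
    rw [this]
    have : 0 ≤ sinh y - y := by linarith
    positivity
  have := key Set.self_mem_Ici hz hz
  simp only [cosh_zero, log_one, zero_mul, add_zero, div_one] at this
  have h2 := cosh_pos z
  have h3 : (1 + z * sinh z) / cosh z - 1 ≤ log (cosh z) := by linarith
  have h4 := mul_le_mul_of_nonneg_left h3 h2.le
  have h5 : cosh z * ((1 + z * sinh z) / cosh z - 1) = 1 + z * sinh z - cosh z := by field_simp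
  linarith

open Real in
/-- With `y = artanh b` and `q = 1 + K coth² y`, the function below is
`log (‖1 + b ε‖_q)`, where `ε` is a random sign. -/
theorem monotoneOn_log_cosh_mul_div {K : ℝ} (hK : 0 ≤ K) :
    MonotoneOn (fun y => log (cosh ((1 + K * (cosh y / sinh y) ^ 2) * y)) /
      (1 + K * (cosh y / sinh y) ^ 2) - log (cosh y)) (Set.Ioi 0) := by
  have hd (y : ℝ) (hy : 0 < y) : HasDerivAt (fun y => 1 + K * (cosh y / sinh y) ^ 2)
      (- 2 * K * cosh y / sinh y ^ 3) y := by
    have hs : 0 < sinh y := sinh_pos_iff.2 hy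
    refine (((((hasDerivAt_cosh y).div (hasDerivAt_sinh y) hs.ne').pow 2).const_mul
      K).const_add 1).congr_deriv ?_
    simp only [Pi.div_apply, Nat.cast_ofNat, Nat.add_one_sub_one, pow_one]
    field_simp
    linear_combination (-K) * cosh_sq y
  have hq (y : ℝ) : 1 ≤ 1 + K * (cosh y / sinh y) ^ 2 := by
    have : 0 ≤ K * (cosh y / sinh y) ^ 2 := by positivity
    linarith
  have hG (y : ℝ) (hy : 0 < y) := ((((hd y hy).mul (hasDerivAt_id y)).cosh.log
    (cosh_pos _).ne').div (hd y hy) (by linarith [hq y] : (1 + K * (cosh y / sinh y) ^ 2) ≠ 0)).sub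
    ((hasDerivAt_cosh y).log (cosh_pos y).ne')
  refine monotoneOn_of_deriv_nonneg (convex_Ioi 0)
    (fun y hy => (hG y hy).continuousAt.continuousWithinAt)
    (fun y hy => (hG y (interior_subset hy)).differentiableAt.differentiableWithinAt)
    fun y hy => ?_
  rw [interior_Ioi, Set.mem_Ioi] at hy
  refine (hG y hy).deriv.symm ▸ ?_
  have hs : 0 < sinh y := sinh_pos_iff.2 hy
  have hc := cosh_pos y
  have hq1 := hq y
  simp only [Pi.mul_apply, id]
  obtain ⟨q, hqdef⟩ : ∃ q, q = 1 + K * (cosh y / sinh y) ^ 2 := ⟨_, rfl⟩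
  rw [← hqdef] at hq1 ⊢
  have hq' : -2 * K * cosh y / sinh y ^ 3 = - (2 * (q - 1)) / (sinh y * cosh y) := by
    rw [hqdef]; field_simp; ring
  rw [hq']
  have hq0 : 0 < q := by linarith
  have hcz := cosh_pos (q * y)
  have h1 := two_mul_cosh_sub_one_le hq1 hy.le
  have h2 := mul_sinh_sub_cosh_mul_log_cosh_le (z := q * y) (by positivity)
  have h3 : sinh ((q - 1) * y) = sinh (q * y) * cosh y - cosh (q * y) * sinh y := by
    rw [← sinh_sub]; ring_nf
  rw [h3] at h1
  have h4 := mul_le_mul_of_nonneg_left h2 (by linarith : 0 ≤ 2 * (q - 1))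
  have h5 := h4.trans h1
  generalize cosh (q * y) = C at *
  generalize sinh (q * y) = S at *
  generalize log C = l at *
  generalize cosh y = c at *
  generalize sinh y = s at *
  have : (S * (-(2 * (q - 1)) / (s * c) * y + q * 1) / C * q -
      l * (-(2 * (q - 1)) / (s * c))) / q ^ 2 - s / c =
      (q ^ 2 * (s * (S * c - C * s)) - 2 * (q - 1) * (q * y * S - C * l)) / (q ^ 2 * C * s * c) := by
    field_simp
    ring
  rw [this]
  exact div_nonneg (by linarith) (by positivity)

/-- The `L^q` norm on the two-point space of the function with values `a` and `b`. -/
noncomputable def twoPointNorm (q a b : ℝ) : ℝ := ((|a| ^ q + |b| ^ q) / 2) ^ (1 / q)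

theorem twoPointNorm_comm (q a b : ℝ) : twoPointNorm q a b = twoPointNorm q b a := by
  simp only [twoPointNorm, add_comm]

theorem twoPointNorm_abs (q a b : ℝ) : twoPointNorm q |a| |b| = twoPointNorm q a b := by
  simp only [twoPointNorm, abs_abs]

theorem twoPointNorm_self {q : ℝ} (hq : 0 < q) (a : ℝ) : twoPointNorm q a a = |a| := by
  rw [twoPointNorm, add_self_div_two, one_div, Real.rpow_rpow_inv (abs_nonneg a) hq.ne']

theorem twoPointNorm_mul {q c : ℝ} (hq : 0 < q) (hc : 0 ≤ c) (a b : ℝ) :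
    twoPointNorm q (c * a) (c * b) = c * twoPointNorm q a b := by
  rw [twoPointNorm, twoPointNorm, abs_mul, abs_mul, abs_of_nonneg hc,
    Real.mul_rpow hc (abs_nonneg a), Real.mul_rpow hc (abs_nonneg b), ← mul_add, mul_div_assoc,
    Real.mul_rpow (by positivity) (by positivity), one_div, Real.rpow_rpow_inv hc hq.ne']

theorem twoPointNorm_mono {q a b a' b' : ℝ} (hq : 0 < q) (ha : |a| ≤ |a'|) (hb : |b| ≤ |b'|) :
    twoPointNorm q a b ≤ twoPointNorm q a' b' := by
  unfold twoPointNorm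
  gcongr

theorem continuous_twoPointNorm {q : ℝ} (hq : 0 < q) {f g : ℝ → ℝ} (hf : Continuous f)
    (hg : Continuous g) : Continuous fun x => twoPointNorm q (f x) (g x) := by
  unfold twoPointNorm
  refine Continuous.rpow_const ?_ fun _ => Or.inr (by positivity)
  exact ((hf.abs.rpow_const fun _ => Or.inr hq.le).add
    (hg.abs.rpow_const fun _ => Or.inr hq.le)).div_const 2

open Real in
theorem log_twoPointNorm_one_add_one_sub {q b : ℝ} (hq : 0 < q) (hb : b ∈ Set.Ioo (-1) 1) :
    log (twoPointNorm q (1 + b) (1 - b)) =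
      log (cosh (q * artanh b)) / q - log (cosh (artanh b)) := by
  set x := artanh b with hx
  have hb' : b = sinh x / cosh x := by rw [← tanh_eq_sinh_div_cosh, tanh_artanh hb]
  have hc := cosh_pos x
  have e1 : |1 + b| = exp x / cosh x := by
    rw [abs_of_pos (by linarith [hb.1]), hb', ← cosh_add_sinh]; field_simp
  have e2 : |1 - b| = exp (-x) / cosh x := by
    rw [abs_of_pos (by linarith [hb.2]), hb', ← cosh_sub_sinh]; field_simp
  have e3 : (|1 + b| ^ q + |1 - b| ^ q) / 2 = cosh (q * x) / cosh x ^ q := by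
    rw [e1, e2, div_rpow (exp_pos _).le hc.le, div_rpow (exp_pos _).le hc.le, ← exp_mul, ← exp_mul,
      cosh_eq (q * x)]
    ring_nf
  have hcq := cosh_pos (q * x)
  rw [twoPointNorm, e3, log_rpow (by positivity), log_div (by positivity) (by positivity),
    log_rpow hc]
  field_simp

theorem twoPointNorm_pos_of_ne_zero {a : ℝ} (q b : ℝ) (ha : a ≠ 0) : 0 < twoPointNorm q a b := by
  unfold twoPointNorm
  have := abs_pos.2 ha
  positivity

open Real in
theorem twoPointNorm_one_add_mul_le {q ρ b : ℝ} (hq : 1 ≤ q) (hρ0 : 0 < ρ) (hρ1 : ρ ≤ 1)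
    (hb0 : 0 < b) (hb1 : b < 1) :
    twoPointNorm q (1 + ρ * b) (1 - ρ * b) ≤
      twoPointNorm (1 + (q - 1) * ρ ^ 2) (1 + b) (1 - b) := by
  have hK : 0 ≤ (q - 1) * (ρ * b) ^ 2 := mul_nonneg (by linarith) (by positivity)
  have hρb0 : 0 < ρ * b := by positivity
  have hρb1 : ρ * b ≤ b := by nlinarith
  have hcoth {x : ℝ} (hx0 : 0 < x) (hx1 : x < 1) :
      cosh (artanh x) / sinh (artanh x) = x⁻¹ := by
    rw [← inv_div, ← tanh_eq_sinh_div_cosh, tanh_artanh ⟨by linarith, hx1⟩]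
  have h := monotoneOn_log_cosh_mul_div hK
    (Set.mem_Ioi.2 (artanh_pos ⟨hρb0, by linarith⟩)) (Set.mem_Ioi.2 (artanh_pos ⟨hb0, hb1⟩))
    (artanh_le_artanh (by linarith) hb1 hρb1)
  simp only [hcoth hρb0 (by linarith), hcoth hb0 hb1] at h
  rw [show 1 + (q - 1) * (ρ * b) ^ 2 * ((ρ * b)⁻¹) ^ 2 = q by field_simp; ring,
    show 1 + (q - 1) * (ρ * b) ^ 2 * (b⁻¹) ^ 2 = 1 + (q - 1) * ρ ^ 2 by field_simp] at h
  have hp : 0 < 1 + (q - 1) * ρ ^ 2 := by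
    have : 0 ≤ (q - 1) * ρ ^ 2 := mul_nonneg (by linarith) (by positivity)
    linarith
  rwa [← log_twoPointNorm_one_add_one_sub (by linarith) ⟨by linarith, by linarith⟩,
    ← log_twoPointNorm_one_add_one_sub hp ⟨by linarith, by linarith⟩,
    log_le_log_iff (twoPointNorm_pos_of_ne_zero _ _ (by positivity))
      (twoPointNorm_pos_of_ne_zero _ _ (by positivity))] at h

/-- Hypercontractivity on the two-point space. -/
theorem twoPointNorm_noise_le {q ρ : ℝ} (hq : 1 ≤ q) (hρ0 : 0 < ρ) (hρ1 : ρ ≤ 1) (a b : ℝ) :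
    twoPointNorm q (((1 + ρ) * a + (1 - ρ) * b) / 2) (((1 - ρ) * a + (1 + ρ) * b) / 2) ≤
      twoPointNorm (1 + (q - 1) * ρ ^ 2) a b := by
  have hq0 : 0 < q := by linarith
  have hp : 0 < 1 + (q - 1) * ρ ^ 2 := by
    have : 0 ≤ (q - 1) * ρ ^ 2 := mul_nonneg (by linarith) (by positivity)
    linarith
  have of_lt {a b : ℝ} (hb : 0 < b) (hab : b < a) :
      twoPointNorm q (((1 + ρ) * a + (1 - ρ) * b) / 2) (((1 - ρ) * a + (1 + ρ) * b) / 2) ≤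
        twoPointNorm (1 + (q - 1) * ρ ^ 2) a b := by
    have hs : 0 < a + b := by linarith
    have h := mul_le_mul_of_nonneg_left
      (twoPointNorm_one_add_mul_le hq hρ0 hρ1 (b := (a - b) / (a + b))
        (div_pos (by linarith) hs) ((div_lt_one hs).2 (by linarith)))
      (by positivity : 0 ≤ (a + b) / 2)
    rw [← twoPointNorm_mul hq0 (by positivity), ← twoPointNorm_mul hp (by positivity)] at h
    have e1 : (a + b) / 2 * (1 + (a - b) / (a + b)) = a := by field_simp; ring
    have e2 : (a + b) / 2 * (1 - (a - b) / (a + b)) = b := by field_simp; ring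
    have e3 : (a + b) / 2 * (1 + ρ * ((a - b) / (a + b))) = ((1 + ρ) * a + (1 - ρ) * b) / 2 := by
      field_simp; ring
    have e4 : (a + b) / 2 * (1 - ρ * ((a - b) / (a + b))) = ((1 - ρ) * a + (1 + ρ) * b) / 2 := by
      field_simp; ring
    rwa [e1, e2, e3, e4] at h
  have of_pos {a b : ℝ} (ha : 0 < a) (hb : 0 < b) :
      twoPointNorm q (((1 + ρ) * a + (1 - ρ) * b) / 2) (((1 - ρ) * a + (1 + ρ) * b) / 2) ≤
        twoPointNorm (1 + (q - 1) * ρ ^ 2) a b := by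
    rcases lt_trichotomy a b with h | rfl | h
    · have := of_lt ha h
      rw [twoPointNorm_comm, twoPointNorm_comm _ a]
      convert this using 2 <;> ring
    · rw [← add_mul, ← add_mul, show (1 + ρ + (1 - ρ)) * a / 2 = a by ring,
        show (1 - ρ + (1 + ρ)) * a / 2 = a by ring, twoPointNorm_self hq0, twoPointNorm_self hp]
    · exact of_lt hb h
  have of_nonneg {a b : ℝ} (ha : 0 ≤ a) (hb : 0 ≤ b) :
      twoPointNorm q (((1 + ρ) * a + (1 - ρ) * b) / 2) (((1 - ρ) * a + (1 + ρ) * b) / 2) ≤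
        twoPointNorm (1 + (q - 1) * ρ ^ 2) a b := by
    have hl := (continuous_twoPointNorm hq0
      (f := fun ε => ((1 + ρ) * (a + ε) + (1 - ρ) * (b + ε)) / 2)
      (g := fun ε => ((1 - ρ) * (a + ε) + (1 + ρ) * (b + ε)) / 2)
      (by fun_prop) (by fun_prop)).continuousWithinAt (s := Set.Ioi 0) (x := 0)
    have hr := (continuous_twoPointNorm hp (f := fun ε => a + ε) (g := fun ε => b + ε)
      (by fun_prop) (by fun_prop)).continuousWithinAt (s := Set.Ioi 0) (x := 0)
    have h := le_of_tendsto_of_tendsto hl.tendsto hr.tendsto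
      (eventually_nhdsWithin_of_forall fun ε (hε : 0 < ε) =>
        of_pos (add_pos_of_nonneg_of_pos ha hε) (add_pos_of_nonneg_of_pos hb hε))
    simpa only [add_zero] using h
  rw [← twoPointNorm_abs _ a b]
  have h1 : 0 ≤ 1 - ρ := by linarith
  have h2 : 0 ≤ 1 + ρ := by linarith
  have key {c d : ℝ} (hc : 0 ≤ c) (hd : 0 ≤ d) :
      |(c * a + d * b) / 2| ≤ |(c * |a| + d * |b|) / 2| := by
    rw [abs_div, abs_div]
    refine div_le_div_of_nonneg_right ?_ (abs_nonneg _)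
    rw [abs_of_nonneg (by positivity : 0 ≤ c * |a| + d * |b|)]
    refine (abs_add_le _ _).trans_eq ?_
    rw [abs_mul, abs_mul, abs_of_nonneg hc, abs_of_nonneg hd]
  exact (twoPointNorm_mono hq0 (key h2 h1) (key h1 h2)).trans
    (of_nonneg (abs_nonneg a) (abs_nonneg b))

theorem EC_cons {n : ℕ} (g : (Fin (n + 1) → Bool) → ℝ) :
    EC g = (EC (fun x => g (Fin.cons true x)) + EC fun x => g (Fin.cons false x)) / 2 := by
  rw [EC, EC, EC, ← (Fin.consEquiv fun _ => Bool).sum_comp, Fintype.sum_prod_type,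
    Fintype.sum_bool, pow_succ]
  simp only [Fin.consEquiv, Equiv.coe_fn_mk]
  field_simp

theorem EC_mono {n : ℕ} {g h : (Fin n → Bool) → ℝ} (hgh : ∀ x, g x ≤ h x) : EC g ≤ EC h :=
  div_le_div_of_nonneg_right (Finset.sum_le_sum fun x _ => hgh x) (by positivity)

theorem EC_nonneg {n : ℕ} {g : (Fin n → Bool) → ℝ} (hg : ∀ x, 0 ≤ g x) : 0 ≤ EC g :=
  div_nonneg (Finset.sum_nonneg fun x _ => hg x) (by positivity)

theorem EC_mul_const {n : ℕ} (g : (Fin n → Bool) → ℝ) (c : ℝ) :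
    EC (fun x => g x * c) = EC g * c := by
  rw [EC, EC, ← Finset.sum_mul, div_mul_eq_mul_div]

theorem EC_abs_rpow_nonneg {n : ℕ} (p : ℝ) (g : (Fin n → Bool) → ℝ) :
    0 ≤ EC fun x => |g x| ^ p :=
  EC_nonneg fun _ => by positivity

theorem normC_nonneg {n : ℕ} (p : ℝ) (g : (Fin n → Bool) → ℝ) : 0 ≤ normC p g :=
  Real.rpow_nonneg (EC_abs_rpow_nonneg p g) _

theorem normC_rpow {n : ℕ} {p : ℝ} (hp : 0 < p) (g : (Fin n → Bool) → ℝ) :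
    normC p g ^ p = EC fun x => |g x| ^ p := by
  rw [normC, one_div, Real.rpow_inv_rpow (EC_abs_rpow_nonneg p g) hp.ne']

theorem Q_cons {n : ℕ} (t : ℝ) (f : (Fin (n + 1) → Bool) → ℝ) (b : Bool) (x : Fin n → Bool) :
    Q t f (Fin.cons b x) =
      ((1 + Real.exp (-t) * sgn b) * Q t (fun y => f (Fin.cons true y)) x +
        (1 - Real.exp (-t) * sgn b) * Q t (fun y => f (Fin.cons false y)) x) / 2 := by
  simp only [Q, EC_cons (n := n), Fin.prod_univ_succ, Fin.cons_zero, Fin.cons_succ]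
  rw [mul_comm _ (EC _), mul_comm _ (EC _), ← EC_mul_const, ← EC_mul_const]
  congr 3 <;> ext y <;> simp [sgn] <;> ring

/-- The triangle inequality in `L^r`, with respect to the uniform measure. -/
theorem EC_add_rpow_le {n : ℕ} {r : ℝ} (hr : 1 ≤ r) {f g : (Fin n → Bool) → ℝ}
    (hf : ∀ x, 0 ≤ f x) (hg : ∀ x, 0 ≤ g x) :
    (EC fun x => (f x + g x) ^ r) ^ (1 / r) ≤
      (EC fun x => f x ^ r) ^ (1 / r) + (EC fun x => g x ^ r) ^ (1 / r) := by
  have hf' : 0 ≤ ∑ x, f x ^ r := Finset.sum_nonneg fun x _ => Real.rpow_nonneg (hf x) r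
  have hg' : 0 ≤ ∑ x, g x ^ r := Finset.sum_nonneg fun x _ => Real.rpow_nonneg (hg x) r
  have hfg : 0 ≤ ∑ x, (f x + g x) ^ r :=
    Finset.sum_nonneg fun x _ => Real.rpow_nonneg (add_nonneg (hf x) (hg x)) r
  simp only [EC]
  rw [Real.div_rpow hf' (by positivity), Real.div_rpow hg' (by positivity),
    Real.div_rpow hfg (by positivity), ← add_div]
  gcongr
  exact Real.Lp_add_le_of_nonneg Finset.univ hr (fun x _ => hf x) fun x _ => hg x

/-- Minkowski's integral inequality for mixed norms on the product of the two-point space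
with the cube. -/
theorem normC_twoPointNorm_le {n : ℕ} {p q : ℝ} (hp : 0 < p) (hpq : p ≤ q)
    (f g : (Fin n → Bool) → ℝ) :
    normC q (fun x => twoPointNorm p (f x) (g x)) ≤
      twoPointNorm p (normC q f) (normC q g) := by
  have hq : 0 < q := hp.trans_le hpq
  have half (h : (Fin n → Bool) → ℝ) :
      (EC fun x => (|h x| ^ p / 2) ^ (q / p)) ^ (1 / (q / p)) = normC q h ^ p / 2 := by
    have e (x : Fin n → Bool) : (|h x| ^ p / 2) ^ (q / p) = |h x| ^ q * (1 / 2) ^ (q / p) := by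
      rw [div_eq_mul_one_div, Real.mul_rpow (by positivity) (by positivity),
        ← Real.rpow_mul (abs_nonneg _), mul_div_cancel₀ _ hp.ne']
    simp only [e]
    rw [EC_mul_const, Real.mul_rpow (EC_abs_rpow_nonneg q h) (by positivity), one_div (q / p),
      Real.rpow_rpow_inv (by positivity) (by positivity), normC,
      ← Real.rpow_mul (EC_abs_rpow_nonneg q h), inv_div, one_div_mul_eq_div, mul_one_div]
  have h := EC_add_rpow_le (r := q / p) ((one_le_div hp).2 hpq)
    (f := fun x => |f x| ^ p / 2) (g := fun x => |g x| ^ p / 2)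
    (fun x => by positivity) (fun x => by positivity)
  rw [half, half] at h
  have e (x : Fin n → Bool) : |twoPointNorm p (f x) (g x)| ^ q =
      (|f x| ^ p / 2 + |g x| ^ p / 2) ^ (q / p) := by
    rw [← add_div, twoPointNorm, abs_of_nonneg (by positivity), ← Real.rpow_mul (by positivity),
      one_div_mul_eq_div]
  have h0 : 0 ≤ EC fun x => (|f x| ^ p / 2 + |g x| ^ p / 2) ^ (q / p) :=
    EC_nonneg fun x => by positivity
  rw [normC, twoPointNorm, abs_of_nonneg (normC_nonneg q f), abs_of_nonneg (normC_nonneg q g),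
    add_div]
  simp only [e]
  calc _ = ((EC fun x => (|f x| ^ p / 2 + |g x| ^ p / 2) ^ (q / p)) ^ (1 / (q / p))) ^ (1 / p) := by
        rw [← Real.rpow_mul h0]
        congr 1
        field_simp
    _ ≤ _ := Real.rpow_le_rpow (Real.rpow_nonneg h0 _) h (by positivity)

theorem normC_cons {n : ℕ} {p : ℝ} (hp : 0 < p) (f : (Fin (n + 1) → Bool) → ℝ) :
    normC p f = twoPointNorm p (normC p fun x => f (Fin.cons true x))
      (normC p fun x => f (Fin.cons false x)) := by
  rw [twoPointNorm, abs_of_nonneg (normC_nonneg _ _), abs_of_nonneg (normC_nonneg _ _),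
    normC_rpow hp, normC_rpow hp, normC, EC_cons]

theorem normC_cons' {n : ℕ} {p : ℝ} (hp : 0 < p) (f : (Fin (n + 1) → Bool) → ℝ) :
    normC p f =
      normC p fun x => twoPointNorm p (f (Fin.cons true x)) (f (Fin.cons false x)) := by
  have e (x : Fin n → Bool) : |twoPointNorm p (f (Fin.cons true x)) (f (Fin.cons false x))| ^ p =
      (|f (Fin.cons true x)| ^ p + |f (Fin.cons false x)| ^ p) / 2 := by
    rw [twoPointNorm, abs_of_nonneg (by positivity), one_div,
      Real.rpow_inv_rpow (by positivity) hp.ne']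
  rw [normC, normC, EC_cons]
  simp only [e, EC, ← Finset.sum_div, Finset.sum_add_distrib]
  ring_nf

theorem normC_mono {n : ℕ} {p : ℝ} (hp : 0 < p) {f g : (Fin n → Bool) → ℝ}
    (h : ∀ x, |f x| ≤ |g x|) : normC p f ≤ normC p g :=
  Real.rpow_le_rpow (EC_abs_rpow_nonneg p f)
    (EC_mono fun x => Real.rpow_le_rpow (abs_nonneg _) (h x) hp.le) (by positivity)

theorem EC_fin_zero (g : (Fin 0 → Bool) → ℝ) (x : Fin 0 → Bool) : EC g = g x := by
  rw [EC, Fintype.sum_subsingleton g x, pow_zero, div_one]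

theorem normC_fin_zero {p : ℝ} (hp : 0 < p) (f : (Fin 0 → Bool) → ℝ) (x : Fin 0 → Bool) :
    normC p f = |f x| := by
  simp [normC, EC_fin_zero _ x, Real.rpow_rpow_inv (abs_nonneg _) hp.ne']

theorem normC_Q_le {n : ℕ} (f : (Fin n → Bool) → ℝ) {t q : ℝ} (ht : 0 ≤ t) (hq : 1 ≤ q) :
    normC q (Q t f) ≤ normC (1 + (q - 1) * Real.exp (-t) ^ 2) f := by
  have hρ0 := Real.exp_pos (-t)
  have hρ1 : Real.exp (-t) ≤ 1 := Real.exp_le_one_iff.2 (by linarith)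
  have hq0 : 0 < q := by linarith
  have htp := twoPointNorm_noise_le hq hρ0 hρ1
  have hp : 0 < 1 + (q - 1) * Real.exp (-t) ^ 2 := by
    have : 0 ≤ (q - 1) * Real.exp (-t) ^ 2 := mul_nonneg (by linarith) (by positivity)
    linarith
  have hpq : 1 + (q - 1) * Real.exp (-t) ^ 2 ≤ q := by
    have : (q - 1) * Real.exp (-t) ^ 2 ≤ q - 1 :=
      mul_le_of_le_one_right (by linarith) (pow_le_one₀ hρ0.le hρ1)
    linarith
  induction n with
  | zero =>
    rw [normC_fin_zero hq0 _ default, normC_fin_zero hp _ default]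
    simp [Q, EC_fin_zero _ default]
  | succ n ih =>
    set p := 1 + (q - 1) * Real.exp (-t) ^ 2 with hpdef
    set F : Bool → (Fin n → Bool) → ℝ := fun b => Q t fun y => f (Fin.cons b y) with hF
    calc normC q (Q t f)
        = normC q fun x => twoPointNorm q (Q t f (Fin.cons true x)) (Q t f (Fin.cons false x)) :=
          normC_cons' hq0 _
      _ ≤ normC q fun x => twoPointNorm p (F true x) (F false x) := by
          refine normC_mono hq0 fun x => abs_le_abs_of_nonneg ?_ ?_
          · exact Real.rpow_nonneg (by positivity) _
          · rw [Q_cons, Q_cons]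
            simpa [sgn, hF, ← sub_eq_add_neg] using htp (F true x) (F false x)
      _ ≤ twoPointNorm p (normC q (F true)) (normC q (F false)) := normC_twoPointNorm_le hp hpq _ _
      _ ≤ twoPointNorm p (normC p fun y => f (Fin.cons true y))
            (normC p fun y => f (Fin.cons false y)) :=
          twoPointNorm_mono hp
            (abs_le_abs_of_nonneg (normC_nonneg _ _) (ih _))
            (abs_le_abs_of_nonneg (normC_nonneg _ _) (ih _))
      _ = normC p f := (normC_cons hp f).symm

/-- Bonami–Beckner hypercontractivity: `‖Q_t f‖_q ≤ ‖f‖_p` with `p = 1 + (q-1)e^{-2t}`. -/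
theorem bonami_beckner_hypercontractivity (n : ℕ) (hn : 1 ≤ n)
    (f : (Fin n → Bool) → ℝ) (t : ℝ) (ht : 0 ≤ t) (q : ℝ) (hq : 1 ≤ q) :
    normC q (Q t f) ≤ normC (1 + (q - 1) * Real.exp (-2 * t)) f := by
  have h : Real.exp (-2 * t) = Real.exp (-t) ^ 2 := by
    rw [← Real.exp_nat_mul]
    push_cast
    ring_nf
  rw [h]
  exact normC_Q_le f ht hq
end

section
/- (Paouris–Valettas) There exist absolute constants C, c > 0 with the following property. Let f : ℝⁿ → ℝ be Lipschitz with |f(x) − f(y)| ≤ b·|x − y|₂ and |f(x) − f(y)| ≤ a·‖x − y‖_∞ for all x, y ∈ ℝⁿ, and suppose ‖∂_i f‖₁ ≤ A for all i ∈ {1,…,n} (where ∂_i f exists almost everywhere by Rademacher's theorem). Set F = f − ∫_{ℝⁿ} f dγ_n. Then for all λ > 0, Var_{γ_n}(e^{λF}) ≤ (C λ² b² / log(e + b²/(aA))) · ∫_{ℝⁿ} e^{2λF} dγ_n, and consequently, for X a standard Gaussian vector in ℝⁿ and all t ≥ 0, ℙ(|f(X) − 𝔼[f(X)]| ≥ t)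 ≤ 4 exp(−c · max{ t²/b², (t/b)·√(log(e + b²/(aA))) }). -/
open MeasureTheory ProbabilityTheory

/-- The standard Gaussian probability measure `γₙ` on `ℝⁿ`. -/
noncomputable def gauss (n : ℕ) : Measure (Fin n → ℝ) :=
  Measure.pi fun _ => gaussianReal 0 1

/-- Variance with respect to `γₙ`. -/
noncomputable def varG {n : ℕ} (f : (Fin n → ℝ) → ℝ) : ℝ :=
  (∫ x, f x ^ 2 ∂gauss n) - (∫ x, f x ∂gauss n) ^ 2

/-- `i`-th partial derivative of `f : ℝⁿ → ℝ`. -/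
noncomputable def pd {n : ℕ} (i : Fin n) (f : (Fin n → ℝ) → ℝ) : (Fin n → ℝ) → ℝ :=
  fun x => fderiv ℝ f x (Pi.single i 1)

/-- Euclidean norm on `ℝⁿ = Fin n → ℝ` (the Pi-type norm `‖·‖` is the sup norm). -/
noncomputable def euclNorm {n : ℕ} (x : Fin n → ℝ) : ℝ :=
  Real.sqrt (∑ i, (x i) ^ 2)

/-- The average of a real function over a finite type. -/
noncomputable def mean {X : Type*} [Fintype X] (g : X → ℝ) : ℝ :=
  (∑ x, g x) / Fintype.card X

section Mean

variable {X : Type*} [Fintype X]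

lemma mean_add (g h : X → ℝ) : mean (fun x => g x + h x) = mean g + mean h := by
  simp [mean, Finset.sum_add_distrib, add_div]

lemma mean_sub (g h : X → ℝ) : mean (fun x => g x - h x) = mean g - mean h := by
  simp [mean, Finset.sum_sub_distrib, sub_div]

lemma mean_const_mul (c : ℝ) (g : X → ℝ) : mean (fun x => c * g x) = c * mean g := by
  simp [mean, ← Finset.mul_sum, mul_div_assoc]

lemma mean_div (g : X → ℝ) (c : ℝ) : mean (fun x => g x / c) = mean g / c := by
  simp only [mean, ← Finset.sum_div, div_right_comm]

lemma mean_mono {g h : X → ℝ} (H : ∀ x, g x ≤ h x) : mean g ≤ mean h := by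
  unfold mean
  gcongr with x
  exact H x

lemma mean_nonneg {g : X → ℝ} (H : ∀ x, 0 ≤ g x) : 0 ≤ mean g :=
  div_nonneg (Finset.sum_nonneg fun x _ => H x) (by positivity)

lemma eq_zero_of_mean_eq_zero {g : X → ℝ} (H : ∀ x, 0 ≤ g x) (h0 : mean g = 0) (x : X) :
    g x = 0 := by
  have : Nonempty X := ⟨x⟩
  have hc : (Fintype.card X : ℝ) ≠ 0 := by simp
  rw [mean, div_eq_zero_iff, or_iff_left hc, Finset.sum_eq_zero_iff_of_nonneg fun x _ => H x] at h0
  exact h0 x (Finset.mem_univ x)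

lemma mean_equiv {Y : Type*} [Fintype Y] (e : X ≃ Y) (g : Y → ℝ) :
    mean (fun x => g (e x)) = mean g := by
  simp only [mean, Fintype.card_congr e, e.sum_comp g]

lemma mean_mul_le_sqrt (g h : X → ℝ) :
    mean (fun x => g x * h x) ≤ √(mean fun x => g x ^ 2) * √(mean fun x => h x ^ 2) := by
  have H := Finset.sum_mul_sq_le_sq_mul_sq Finset.univ g h
  rw [← Real.sqrt_mul (mean_nonneg fun _ => sq_nonneg _)]
  apply Real.le_sqrt_of_sq_le
  unfold mean
  rw [div_pow, div_mul_div_comm, ← sq]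
  gcongr

end Mean

/-- The entropy of a nonnegative function with respect to the uniform measure. -/
noncomputable def entropy {X : Type*} [Fintype X] (g : X → ℝ) : ℝ :=
  mean (fun x => g x * Real.log (g x)) - mean g * Real.log (mean g)

lemma log_mul_mean_sq_le {X : Type*} [Fintype X] (h : X → ℝ) {θ : ℝ} (hθ : 0 < θ) :
    Real.log θ * mean (fun x => h x ^ 2) ≤
      θ * mean (fun x => |h x|) ^ 2 + entropy fun x => h x ^ 2 := by
  set v := mean (fun x => h x ^ 2) with hv
  have hv0 : 0 ≤ v := mean_nonneg fun _ => sq_nonneg _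
  rcases hv0.eq_or_lt with h0 | hpos
  · have hz : ∀ x, h x ^ 2 = 0 := eq_zero_of_mean_eq_zero (fun _ => sq_nonneg _) h0.symm
    simp only [entropy, hz]
    rw [← h0]
    have : mean (fun _ : X => (0 : ℝ)) = 0 := by simp [mean]
    simp only [this, zero_mul, sub_zero, mul_zero, add_zero]
    positivity
  · have key : ∀ x, 2 * h x ^ 2 - 2 * √(v * θ) * |h x| ≤
        h x ^ 2 * Real.log (h x ^ 2) - (Real.log v + Real.log θ) * h x ^ 2 := by
      intro x
      rcases eq_or_ne (h x) 0 with hx | hx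
      · simp [hx]
      · have hs : 0 < √(v * θ) := Real.sqrt_pos.2 (by positivity)
        have hax : 0 < |h x| := abs_pos.2 hx
        have h1 := Real.one_sub_inv_le_log_of_pos (div_pos hax hs)
        have h2 : Real.log (h x ^ 2) - (Real.log v + Real.log θ) =
            2 * Real.log (|h x| / √(v * θ)) := by
          rw [Real.log_div hax.ne' hs.ne', Real.log_sqrt (by positivity),
            Real.log_mul hpos.ne' hθ.ne', ← sq_abs, Real.log_pow]
          push_cast; ring
        have h3 : h x ^ 2 * Real.log (h x ^ 2) - (Real.log v + Real.log θ) * h x ^ 2 =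
            |h x| ^ 2 * (2 * Real.log (|h x| / √(v * θ))) := by rw [← h2, sq_abs]; ring
        rw [h3]
        have h4 : 2 * h x ^ 2 - 2 * √(v * θ) * |h x| =
            |h x| ^ 2 * (2 * (1 - (|h x| / √(v * θ))⁻¹)) := by
          rw [← sq_abs (h x)]; field_simp
        rw [h4]
        gcongr
    have hm := mean_mono key
    rw [mean_sub, mean_sub, mean_const_mul, mean_const_mul, mean_const_mul, ← hv] at hm
    have hs : √(v * θ) ^ 2 = v * θ := Real.sq_sqrt (by positivity)
    have hsv : √v ^ 2 = v := Real.sq_sqrt hv0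
    have hst : √θ ^ 2 = θ := Real.sq_sqrt hθ.le
    have hmul : √(v * θ) = √v * √θ := Real.sqrt_mul hv0 θ
    rw [hmul] at hm
    simp only [entropy, ← hv]
    nlinarith [sq_nonneg (√v - √θ * mean (fun x => |h x|))]

lemma two_point_entropy_le {u v : ℝ} (hu : 0 ≤ u) (hv : 0 ≤ v) :
    (u * Real.log u + v * Real.log v) / 2 - (u + v) / 2 * Real.log ((u + v) / 2) ≤
      (√u - √v) ^ 2 := by
  rcases (add_nonneg hu hv).eq_or_lt with h0 | hpos
  · have hu0 : u = 0 := by linarith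
    have hv0 : v = 0 := by linarith
    simp [hu0, hv0]
  · set m := (u + v) / 2 with hm
    have hmpos : 0 < m := by positivity
    have key : ∀ w, 0 ≤ w → w * Real.log w - w * Real.log m ≤ w * (w / m - 1) := by
      intro w hw
      rcases hw.eq_or_lt with h | h
      · simp [← h]
      · rw [← mul_sub, ← Real.log_div h.ne' hmpos.ne']
        gcongr
        exact Real.log_le_sub_one_of_pos (by positivity)
    have h1 := key u hu
    have h2 := key v hv
    have h3 : (u * Real.log u + v * Real.log v) / 2 - m * Real.log m ≤
        (u - v) ^ 2 / (4 * m) := by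
      have : (u - v) ^ 2 / (4 * m) = (u * (u / m - 1) + v * (v / m - 1)) / 2 := by
        field_simp
        rw [hm]; ring
      rw [this]
      have : m * Real.log m = (u * Real.log m + v * Real.log m) / 2 := by rw [hm]; ring
      linarith
    refine h3.trans ?_
    rw [div_le_iff₀ (by positivity)]
    have hsu : √u ^ 2 = u := Real.sq_sqrt hu
    have hsv : √v ^ 2 = v := Real.sq_sqrt hv
    have h4 : 4 * m = 2 * (√u ^ 2 + √v ^ 2) := by rw [hsu, hsv, hm]; ring
    have h5 : (u - v) ^ 2 = (√u - √v) ^ 2 * (√u + √v) ^ 2 := by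
      rw [← mul_pow]
      congr 1
      nlinarith
    rw [h4, h5]
    gcongr
    nlinarith [sq_nonneg (√u - √v)]

/-- Flip the `i`-th coordinate of a point of the discrete cube. -/
def cubeFlip {ι : Type*} [DecidableEq ι] (i : ι) (x : ι → Bool) : ι → Bool :=
  Function.update x i (!x i)

lemma cubeFlip_zero_cons {N : ℕ} (b : Bool) (y : Fin N → Bool) :
    cubeFlip 0 (Fin.cons b y : Fin (N + 1) → Bool) = Fin.cons (!b) y := by
  simp [cubeFlip, Fin.update_cons_zero]

lemma cubeFlip_succ_cons {N : ℕ} (i : Fin N) (b : Bool) (y : Fin N → Bool) :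
    cubeFlip i.succ (Fin.cons b y : Fin (N + 1) → Bool) = Fin.cons b (cubeFlip i y) := by
  simp [cubeFlip, Fin.cons_update]

lemma mean_cons {N : ℕ} (g : (Fin (N + 1) → Bool) → ℝ) :
    mean g = (mean (fun y => g (Fin.cons false y)) + mean (fun y => g (Fin.cons true y))) / 2 := by
  rw [← mean_equiv (Fin.consEquiv fun _ => Bool) g]
  simp only [mean, Fintype.sum_prod_type, Fintype.sum_bool,
    Fintype.card_prod, Fintype.card_bool]
  push_cast
  rw [← add_div, div_div, mul_comm (2 : ℝ), add_comm]
  rfl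

/-- The logarithmic Sobolev inequality on the discrete cube, up to a constant. -/
lemma entropy_sq_le {N : ℕ} (g : (Fin N → Bool) → ℝ) :
    entropy (fun x => g x ^ 2) ≤ ∑ i, mean fun x => (g x - g (cubeFlip i x)) ^ 2 := by
  induction N with
  | zero => simp [entropy, mean]
  | succ N ih =>
    have h0 := ih fun y => g (Fin.cons false y)
    have h1 := ih fun y => g (Fin.cons true y)
    rw [Fin.sum_univ_succ]
    simp only [entropy] at h0 h1 ⊢
    simp only [mean_cons (N := N), cubeFlip_zero_cons, cubeFlip_succ_cons, Bool.not_false, Bool.not_true]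
    rw [← Finset.sum_div, Finset.sum_add_distrib]
    set u := mean fun y => g (Fin.cons false y) ^ 2
    set v := mean fun y => g (Fin.cons true y) ^ 2
    have hu : 0 ≤ u := mean_nonneg fun _ => sq_nonneg _
    have hv : 0 ≤ v := mean_nonneg fun _ => sq_nonneg _
    have h2 := two_point_entropy_le hu hv
    have h3 := mean_mul_le_sqrt (fun y => g (Fin.cons false y)) (fun y => g (Fin.cons true y))
    have h4 : (mean fun y => (g (Fin.cons false y) - g (Fin.cons true y)) ^ 2) =
        u + v - 2 * mean (fun y => g (Fin.cons false y) * g (Fin.cons true y)) := by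
      rw [← mean_add, ← mean_const_mul, ← mean_sub]
      congr 1; ext y; ring
    have h5 : (mean fun y => (g (Fin.cons true y) - g (Fin.cons false y)) ^ 2) =
        mean fun y => (g (Fin.cons false y) - g (Fin.cons true y)) ^ 2 := by
      congr 1; ext y; ring
    rw [h5, h4]
    change mean (fun y => g (Fin.cons false y) * g (Fin.cons true y)) ≤ √u * √v at h3
    nlinarith [Real.sq_sqrt hu, Real.sq_sqrt hv]

lemma log_mul_variance_le_fin {θ : ℝ} (hθ : 0 < θ) {N : ℕ} (g : (Fin N → Bool) → ℝ) :
    Real.log θ * (mean (fun x => g x ^ 2) - mean g ^ 2) ≤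
      θ / 4 * ∑ i, mean (fun x => |g x - g (cubeFlip i x)|) ^ 2 +
        ∑ i, mean fun x => (g x - g (cubeFlip i x)) ^ 2 := by
  induction N with
  | zero => simp [mean]
  | succ N ih =>
    set g0 := fun y : Fin N → Bool => g (Fin.cons false y) with hg0
    set g1 := fun y : Fin N → Bool => g (Fin.cons true y) with hg1
    have h0 := ih fun y => 1 / 2 * (g0 y + g1 y)
    have h1 := log_mul_mean_sq_le (fun y => 1 / 2 * (g0 y - g1 y)) hθ
    have h2 := entropy_sq_le fun y => 1 / 2 * (g0 y - g1 y)
    have hvar : mean (fun x => g x ^ 2) - mean g ^ 2 =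
        (mean (fun y => (1 / 2 * (g0 y + g1 y)) ^ 2) - mean (fun y => 1 / 2 * (g0 y + g1 y)) ^ 2)
          + mean (fun y => (1 / 2 * (g0 y - g1 y)) ^ 2) := by
      have h3 : mean (fun x => g x ^ 2) = mean (fun y => (1 / 2 * (g0 y + g1 y)) ^ 2) +
          mean (fun y => (1 / 2 * (g0 y - g1 y)) ^ 2) := by
        rw [mean_cons, ← mean_add, ← mean_add, ← mean_div]
        congr 1; ext y; simp only [hg0, hg1]; ring
      have h4 : mean (fun y => 1 / 2 * (g0 y + g1 y)) = mean g := by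
        rw [mean_const_mul, mean_add, mean_cons g]; ring
      rw [h3, h4]; ring
    have hE : ∀ i : Fin N, mean (fun x => (g x - g (cubeFlip i.succ x)) ^ 2) =
        mean (fun y => (1 / 2 * (g0 y + g1 y) - 1 / 2 * (g0 (cubeFlip i y) + g1 (cubeFlip i y))) ^ 2) +
        mean (fun y => (1 / 2 * (g0 y - g1 y) - 1 / 2 * (g0 (cubeFlip i y) - g1 (cubeFlip i y))) ^ 2) := by
      intro i
      rw [mean_cons, ← mean_add, ← mean_add, ← mean_div]
      congr 1; ext y; simp only [hg0, hg1, cubeFlip_succ_cons]; ring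
    have hL : ∀ i : Fin N,
        mean (fun y => |1 / 2 * (g0 y + g1 y) - 1 / 2 * (g0 (cubeFlip i y) + g1 (cubeFlip i y))|) ≤
        mean (fun x => |g x - g (cubeFlip i.succ x)|) := by
      intro i
      rw [mean_cons, ← mean_add, ← mean_div]
      apply mean_mono
      intro y
      simp only [cubeFlip_succ_cons]
      have := abs_add_le (g0 y - g0 (cubeFlip i y)) (g1 y - g1 (cubeFlip i y))
      calc _ = |1 / 2 * ((g0 y - g0 (cubeFlip i y)) + (g1 y - g1 (cubeFlip i y)))| := by congr 1; ring
        _ ≤ _ := by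
          rw [abs_mul, abs_of_pos (by norm_num : (0 : ℝ) < 1 / 2)]
          linarith
    have hL0 : mean (fun x => |g x - g (cubeFlip 0 x)|) =
        2 * mean (fun y => |1 / 2 * (g0 y - g1 y)|) := by
      rw [mean_cons, ← mean_add, ← mean_div, ← mean_const_mul]
      congr 1; ext y
      simp only [cubeFlip_zero_cons, Bool.not_false, Bool.not_true, abs_mul]
      rw [abs_sub_comm (g (Fin.cons true y))]
      norm_num; ring
    have hE0 : 0 ≤ mean (fun x => (g x - g (cubeFlip 0 x)) ^ 2) := mean_nonneg fun _ => sq_nonneg _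
    rw [hvar, Fin.sum_univ_succ, Fin.sum_univ_succ, hL0, Finset.sum_congr rfl fun i _ => hE i,
      Finset.sum_add_distrib]
    have hsum : θ / 4 * ∑ i : Fin N,
        mean (fun y => |1 / 2 * (g0 y + g1 y) - 1 / 2 * (g0 (cubeFlip i y) + g1 (cubeFlip i y))|) ^ 2 ≤
        θ / 4 * ∑ i : Fin N, mean (fun x => |g x - g (cubeFlip i.succ x)|) ^ 2 := by
      gcongr with i
      · exact mean_nonneg fun _ => abs_nonneg _
      · exact hL i
    linarith

/-- The `L¹`-`L²` inequality of Falik and Samorodnitsky on the discrete cube. -/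
lemma log_mul_variance_le {ι : Type*} [Fintype ι] [DecidableEq ι] {θ : ℝ} (hθ : 0 < θ)
    (g : (ι → Bool) → ℝ) :
    Real.log θ * (mean (fun x => g x ^ 2) - mean g ^ 2) ≤
      θ / 4 * ∑ i, mean (fun x => |g x - g (cubeFlip i x)|) ^ 2 +
        ∑ i, mean fun x => (g x - g (cubeFlip i x)) ^ 2 := by
  let e := Fintype.equivFin ι
  let E : (Fin (Fintype.card ι) → Bool) ≃ (ι → Bool) := e.symm.arrowCongr (Equiv.refl Bool)
  have hE : ∀ i y, cubeFlip i (E y) = E (cubeFlip (e i) y) := by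
    intro i y
    ext j
    simp only [cubeFlip, E, Equiv.arrowCongr_apply, Equiv.symm_symm, Equiv.coe_refl, Function.comp_apply,
      id, Function.update_apply, e.apply_eq_iff_eq]
  have H := log_mul_variance_le_fin hθ fun y => g (E y)
  rw [← e.sum_comp (fun i => mean (fun x => |g (E x) - g (E (cubeFlip i x))|) ^ 2),
    ← e.sum_comp (fun i => mean (fun x => (g (E x) - g (E (cubeFlip i x))) ^ 2))] at H
  simp only [← hE] at H
  rwa [mean_equiv E (fun x => g x ^ 2), mean_equiv E g,
    Finset.sum_congr rfl fun i _ => mean_equiv E (fun x => (g x - g (cubeFlip i x)) ^ 2),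
    Finset.sum_congr rfl fun i _ => congrArg (· ^ 2)
      (mean_equiv E (fun x => |g x - g (cubeFlip i x)|))] at H

instance isProbabilityMeasure_gauss (n : ℕ) : IsProbabilityMeasure (gauss n) := by
  unfold gauss; infer_instance

/-- The law of a fair coin. -/
noncomputable def coin : Measure Bool := (PMF.uniformOfFintype Bool).toMeasure

instance isProbabilityMeasure_coin : IsProbabilityMeasure coin := by
  unfold coin; infer_instance

/-- The sign associated with a coin toss. -/
def coinSign (b : Bool) : ℝ := if b then 1 else -1

lemma integral_eq_mean_of_measureReal_singleton {X : Type*} [Fintype X] [MeasurableSpace X]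
    [MeasurableSingletonClass X] (μ : Measure X) [IsProbabilityMeasure μ] {c : ℝ}
    (h : ∀ x, μ.real {x} = c) (f : X → ℝ) : ∫ x, f x ∂μ = mean f := by
  have h1 : ∑ x : X, μ.real {x} = 1 := by
    rw [sum_measureReal_singleton]; simp
  simp only [h, Finset.sum_const, Finset.card_univ, nsmul_eq_mul] at h1
  rw [integral_fintype (Integrable.of_finite)]
  simp only [h, smul_eq_mul, ← Finset.mul_sum, mean]
  have hc : (Fintype.card X : ℝ) ≠ 0 := fun h0 => by simp [h0] at h1
  field_simp
  linear_combination (∑ x, f x) * h1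

lemma coin_singleton (b : Bool) : coin {b} = 2⁻¹ := by
  rw [coin, PMF.toMeasure_apply_singleton _ _ (measurableSet_singleton b)]
  simp

lemma integral_pi_pi_coin {n m : ℕ} (f : (Fin n → Fin m → Bool) → ℝ) :
    ∫ x, f x ∂(Measure.pi fun _ : Fin n => Measure.pi fun _ : Fin m => coin) =
      mean fun x : Fin n × Fin m → Bool => f fun i k => x (i, k) := by
  rw [integral_eq_mean_of_measureReal_singleton _ (c := (((2 : ENNReal)⁻¹ ^ m) ^ n).toReal)]
  · exact (mean_equiv (Equiv.curry (Fin n) (Fin m) Bool) f).symm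
  · intro x
    simp [Measure.real, coin_singleton]

/-- The normalized sum of coin signs. -/
noncomputable def signSum (m : ℕ) (x : Fin m → Bool) : ℝ := (√m)⁻¹ * ∑ k, coinSign (x k)

/-- The law of the normalized sum of coin signs. -/
noncomputable def signSumLaw (m : ℕ) : ProbabilityMeasure ℝ :=
  ⟨(Measure.pi fun _ : Fin m => coin).map (signSum m),
    Measure.isProbabilityMeasure_map (measurable_of_finite _).aemeasurable⟩

/-- The standard Gaussian law as a `ProbabilityMeasure`. -/
noncomputable def stdGaussianLaw : ProbabilityMeasure ℝ := ⟨gaussianReal 0 1, inferInstance⟩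

lemma charFun_signSumLaw (m : ℕ) (t : ℝ) :
    charFun (signSumLaw m : Measure ℝ) t = charFun (coin.map coinSign) ((√m)⁻¹ * t) ^ m := by
  rw [charFun_apply_real, charFun_apply_real]
  change ∫ x, _ ∂((Measure.pi fun _ : Fin m => coin).map (signSum m)) = _
  rw [integral_map (measurable_of_finite _).aemeasurable (by fun_prop),
    integral_map (measurable_of_finite _).aemeasurable (by fun_prop)]
  have h := integral_fintype_prod_eq_pow (ι := Fin m) (μ := coin) (𝕜 := ℂ)
    fun b => Complex.exp (((√m)⁻¹ * t : ℝ) * (coinSign b : ℂ) * Complex.I)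
  rw [Fintype.card_fin] at h
  rw [← h]
  congr 1; ext x
  rw [← Complex.exp_sum, signSum]
  congr 1
  push_cast
  rw [Finset.mul_sum, Finset.mul_sum, Finset.sum_mul]
  exact Finset.sum_congr rfl fun k _ => by ring

lemma integral_coin (f : Bool → ℝ) : ∫ b, f b ∂coin = (f true + f false) / 2 := by
  rw [integral_eq_mean_of_measureReal_singleton coin (c := 2⁻¹)]
  · simp [mean]
  · intro b; simp [Measure.real, coin_singleton]

lemma tendsto_signSumLaw :
    Filter.Tendsto signSumLaw Filter.atTop (nhds stdGaussianLaw) := by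
  refine ProbabilityMeasure.tendsto_of_tendsto_charFun fun t => ?_
  simp only [charFun_signSumLaw]
  have := tendsto_charFun_inv_sqrt_mul_pow (P := coin) (X := coinSign)
    (measurable_of_finite _).aemeasurable (by rw [integral_coin]; simp [coinSign])
    (by rw [integral_coin]; simp [coinSign]) t
  convert! this using 2
  change charFun (gaussianReal 0 1) t = _
  simp [charFun_gaussianReal, neg_div]

/-- The multidimensional normalized sum of coin signs. -/
noncomputable def signSums (n m : ℕ) (x : Fin n × Fin m → Bool) (i : Fin n) : ℝ :=
  signSum m fun k => x (i, k)

/-- The central limit theorem for sums of independent signs. -/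
lemma tendsto_mean_signSums {n : ℕ} (h : BoundedContinuousFunction (Fin n → ℝ) ℝ) :
    Filter.Tendsto (fun m => mean fun x => h (signSums n m x)) Filter.atTop
      (nhds (∫ x, h x ∂gauss n)) := by
  have h1 : Filter.Tendsto (fun m => ProbabilityMeasure.pi fun _ : Fin n => signSumLaw m)
      Filter.atTop (nhds (ProbabilityMeasure.pi fun _ : Fin n => stdGaussianLaw)) :=
    (ProbabilityMeasure.continuous_pi.tendsto _).comp
      (tendsto_pi_nhds.2 fun _ => tendsto_signSumLaw)
  rw [ProbabilityMeasure.tendsto_iff_forall_integral_tendsto] at h1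
  convert! h1 h using 2 with m
  have h2 : (ProbabilityMeasure.pi fun _ : Fin n => signSumLaw m).toMeasure =
      (Measure.pi fun _ : Fin n => Measure.pi fun _ : Fin m => coin).map
        fun x i => signSum m (x i) := by
    rw [Measure.pi_map_pi (f := fun _ => signSum m) fun _ => (measurable_of_finite _).aemeasurable]
    rfl
  rw [h2, integral_map (measurable_of_finite _).aemeasurable
    h.continuous.aestronglyMeasurable, integral_pi_pi_coin]
  rfl

lemma tendsto_mean_signSums_of_bounded {n : ℕ} {h : (Fin n → ℝ) → ℝ} (hc : Continuous h)
    {C : ℝ} (hC : ∀ x, ‖h x‖ ≤ C) :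
    Filter.Tendsto (fun m => mean fun x => h (signSums n m x)) Filter.atTop
      (nhds (∫ x, h x ∂gauss n)) :=
  tendsto_mean_signSums (BoundedContinuousFunction.ofNormedAddCommGroup h hc C hC)

lemma exists_abs_sub_le_of_uniformContinuous_fderiv {n : ℕ} {g : (Fin n → ℝ) → ℝ}
    (hg : Differentiable ℝ g) (hu : UniformContinuous (fderiv ℝ g)) {η : ℝ} (hη : 0 < η) :
    ∃ δ > 0, ∀ (x : Fin n → ℝ) (i : Fin n) (τ : ℝ), |τ| < δ →
      |g x - g (x + Pi.single i τ)| ≤ |τ| * (|pd i g x| + η) := by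
  obtain ⟨δ, hδ, H⟩ := Metric.uniformContinuous_iff.1 hu η hη
  refine ⟨δ, hδ, fun x i τ hτ => ?_⟩
  have h1 : (Pi.single i τ : Fin n → ℝ) = τ • Pi.single i 1 := by
    rw [← Pi.single_smul]; simp
  have h2 : ‖(Pi.single i τ : Fin n → ℝ)‖ = |τ| := by
    rw [Pi.norm_single, Real.norm_eq_abs]
  have h3 := (convex_ball x δ).norm_image_sub_le_of_norm_fderiv_le' (𝕜 := ℝ) (f := g)
    (φ := fderiv ℝ g x) (C := η) (x := x) (y := x + Pi.single i τ) (fun y _ => hg y)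
    (fun y hy => by
      rw [← dist_eq_norm]
      exact (H hy).le) (Metric.mem_ball_self hδ) (by simpa [h2] using hτ)
  rw [add_sub_cancel_left, h2, h1, map_smul, ← h1, Real.norm_eq_abs, smul_eq_mul] at h3
  have h4 : |τ * fderiv ℝ g x (Pi.single i 1)| = |τ| * |pd i g x| := by rw [abs_mul]; rfl
  have h5 := abs_add_le (g (x + Pi.single i τ) - g x - τ * fderiv ℝ g x (Pi.single i 1))
    (τ * fderiv ℝ g x (Pi.single i 1))
  rw [sub_add_cancel, h4] at h5
  rw [abs_sub_comm]
  linarith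

lemma signSums_cubeFlip {n m : ℕ} (i : Fin n) (k : Fin m) (x : Fin n × Fin m → Bool) :
    ∃ τ : ℝ, |τ| = 2 * (√m)⁻¹ ∧
      signSums n m (cubeFlip (i, k) x) = signSums n m x + Pi.single i τ := by
  refine ⟨(√m)⁻¹ * (-2 * coinSign (x (i, k))), ?_, ?_⟩
  · rw [abs_mul, abs_of_nonneg (by positivity : 0 ≤ (√(m : ℝ))⁻¹), mul_comm]
    congr 1
    rcases h : x (i, k) <;> simp [coinSign]
  · ext j
    rw [Pi.add_apply]
    rcases eq_or_ne j i with rfl | hj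
    · simp only [signSums, signSum, Pi.single_eq_same]
      rw [← mul_add]
      congr 1
      rw [← sub_eq_iff_eq_add', ← Finset.sum_sub_distrib, Finset.sum_eq_single k]
      · rcases h : x (j, k) <;> simp [cubeFlip, coinSign, h] <;> norm_num
      · intro l _ hl
        simp [cubeFlip, hl]
      · simp
    · simp [signSums, cubeFlip, hj]

set_option maxHeartbeats 1000000 in
lemma log_mul_varG_le_of_contDiff {n : ℕ} {θ : ℝ} (hθ : 0 < θ) {g : (Fin n → ℝ) → ℝ}
    (hg : ContDiff ℝ 1 g) (hs : HasCompactSupport g) :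
    Real.log θ * varG g ≤
      θ * ∑ i, (∫ x, |pd i g x| ∂gauss n) ^ 2 + 4 * ∑ i, ∫ x, pd i g x ^ 2 ∂gauss n := by
  have hd : Differentiable ℝ g := hg.differentiable (by norm_num)
  have hcf : Continuous (fderiv ℝ g) := hg.continuous_fderiv (by norm_num)
  have hu : UniformContinuous (fderiv ℝ g) :=
    (hs.fderiv ℝ).uniformContinuous_of_continuous hcf
  obtain ⟨C, hC⟩ := hs.exists_bound_of_continuous hg.continuous
  obtain ⟨D, hD⟩ := (hs.fderiv ℝ).exists_bound_of_continuous hcf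
  have hpc : ∀ i, Continuous (pd i g) := fun i => hcf.clm_apply continuous_const
  have hpD : ∀ i x, |pd i g x| ≤ D := fun i x => by
    have := (fderiv ℝ g x).le_opNorm (Pi.single i 1)
    rw [Pi.norm_single, norm_one, mul_one] at this
    exact this.trans (hD x)
  have hi1 : ∀ i, Integrable (fun x => |pd i g x|) (gauss n) := fun i =>
    Integrable.of_bound (hpc i).abs.aestronglyMeasurable D
      (Filter.Eventually.of_forall fun x => by simpa using hpD i x)
  have hi2 : ∀ i, Integrable (fun x => pd i g x ^ 2) (gauss n) := fun i =>
    Integrable.of_bound ((hpc i).pow 2).aestronglyMeasurable (D ^ 2)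
      (Filter.Eventually.of_forall fun x => by
        rw [norm_pow, Real.norm_eq_abs]
        exact pow_le_pow_left₀ (abs_nonneg _) (hpD i x) 2)
  have key : ∀ η : ℝ, 0 < η → Real.log θ * varG g ≤
      θ * ∑ i, ((∫ x, |pd i g x| ∂gauss n) + η) ^ 2 +
        4 * ∑ i, ∫ x, (|pd i g x| + η) ^ 2 ∂gauss n := by
    intro η hη
    obtain ⟨δ, hδ, H⟩ := exists_abs_sub_le_of_uniformContinuous_fderiv hd hu hη
    have hm : ∀ᶠ m : ℕ in Filter.atTop, 2 * (√m)⁻¹ < δ := by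
      have : Filter.Tendsto (fun m : ℕ => 2 * (√(m : ℝ))⁻¹) Filter.atTop (nhds (2 * 0)) :=
        (tendsto_inv_atTop_zero.comp
          (Real.tendsto_sqrt_atTop.comp tendsto_natCast_atTop_atTop)).const_mul 2
      rw [mul_zero] at this
      exact this.eventually_lt_const hδ
    have hL : Filter.Tendsto (fun m => Real.log θ * (mean (fun x => g (signSums n m x) ^ 2) -
        mean (fun x => g (signSums n m x)) ^ 2)) Filter.atTop
        (nhds (Real.log θ * varG g)) := by
      refine Filter.Tendsto.const_mul _ (Filter.Tendsto.sub ?_ (Filter.Tendsto.pow ?_ 2))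
      · refine tendsto_mean_signSums_of_bounded (h := fun x => g x ^ 2) (hg.continuous.pow 2)
          (C := C ^ 2) fun x => ?_
        rw [norm_pow]
        exact pow_le_pow_left₀ (norm_nonneg _) (hC x) 2
      · exact tendsto_mean_signSums_of_bounded (h := g) hg.continuous hC
    have hR : Filter.Tendsto (fun m =>
        θ * ∑ i, (mean (fun x => |pd i g (signSums n m x)|) + η) ^ 2 +
        4 * ∑ i, mean fun x => (|pd i g (signSums n m x)| + η) ^ 2) Filter.atTop
        (nhds (θ * ∑ i, ((∫ x, |pd i g x| ∂gauss n) + η) ^ 2 +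
        4 * ∑ i, ∫ x, (|pd i g x| + η) ^ 2 ∂gauss n)) := by
      refine Filter.Tendsto.add (Filter.Tendsto.const_mul _ (tendsto_finsetSum _ fun i _ => ?_))
        (Filter.Tendsto.const_mul _ (tendsto_finsetSum _ fun i _ => ?_))
      · refine Filter.Tendsto.pow (Filter.Tendsto.add_const _ ?_) 2
        exact tendsto_mean_signSums_of_bounded (h := fun x => |pd i g x|) (hpc i).abs (C := D) fun x => by
          simpa using hpD i x
      · refine tendsto_mean_signSums_of_bounded (h := fun x => (|pd i g x| + η) ^ 2)
          (((hpc i).abs.add continuous_const).pow 2) (C := (D + η) ^ 2) fun x => ?_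
        rw [norm_pow, Real.norm_eq_abs, abs_of_nonneg (by positivity)]
        have := hpD i x
        gcongr
    refine le_of_tendsto_of_tendsto hL hR ?_
    filter_upwards [hm, Filter.eventually_gt_atTop 0] with m hmδ hm0
    refine (log_mul_variance_le hθ fun x => g (signSums n m x)).trans ?_
    have hmne : (√(m : ℝ)) ≠ 0 := (Real.sqrt_pos.2 (by exact_mod_cast hm0)).ne'
    have hinv : (m : ℝ) * (√(m : ℝ))⁻¹ ^ 2 = 1 := by
      rw [inv_pow, Real.sq_sqrt (by positivity)]
      exact mul_inv_cancel₀ (by exact_mod_cast hm0.ne')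
    have hpt : ∀ i k x, |g (signSums n m x) - g (signSums n m (cubeFlip (i, k) x))| ≤
        2 * (√m)⁻¹ * (|pd i g (signSums n m x)| + η) := by
      intro i k x
      obtain ⟨τ, h1, h2⟩ := signSums_cubeFlip i k x
      rw [h2, ← h1]
      exact H _ i τ (h1 ▸ hmδ)
    have hX : mean (fun _ : Fin n × Fin m → Bool => η) = η := by simp [mean]
    have h1 : ∀ i k, mean (fun x =>
        |g (signSums n m x) - g (signSums n m (cubeFlip (i, k) x))|) ≤
        2 * (√m)⁻¹ * (mean (fun x => |pd i g (signSums n m x)|) + η) := by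
      intro i k
      refine (mean_mono (hpt i k)).trans_eq ?_
      rw [mean_const_mul, mean_add, hX]
    have h2 : ∀ i k, mean (fun x =>
        (g (signSums n m x) - g (signSums n m (cubeFlip (i, k) x))) ^ 2) ≤
        (2 * (√m)⁻¹) ^ 2 * mean (fun x => (|pd i g (signSums n m x)| + η) ^ 2) := by
      intro i k
      rw [← mean_const_mul]
      refine mean_mono fun x => ?_
      rw [← sq_abs, ← mul_pow]
      exact pow_le_pow_left₀ (abs_nonneg _) (hpt i k x) 2
    rw [Fintype.sum_prod_type, Fintype.sum_prod_type]
    refine add_le_add ?_ ?_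
    · rw [div_mul_eq_mul_div, mul_div_assoc]
      refine mul_le_mul_of_nonneg_left ?_ hθ.le
      rw [Finset.sum_div]
      refine Finset.sum_le_sum fun i _ => ?_
      rw [div_le_iff₀ (by norm_num)]
      refine (Finset.sum_le_sum fun k _ => pow_le_pow_left₀
        (mean_nonneg fun _ => abs_nonneg _) (h1 i k) 2).trans_eq ?_
      simp only [Finset.sum_const, Finset.card_univ, Fintype.card_fin, nsmul_eq_mul]
      linear_combination 4 * (mean (fun x => |pd i g (signSums n m x)|) + η) ^ 2 * hinv
    · rw [Finset.mul_sum]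
      refine Finset.sum_le_sum fun i _ => ?_
      refine (Finset.sum_le_sum fun k _ => h2 i k).trans_eq ?_
      simp only [Finset.sum_const, Finset.card_univ, Fintype.card_fin, nsmul_eq_mul]
      linear_combination 4 * mean (fun x => (|pd i g (signSums n m x)| + η) ^ 2) * hinv
  have hexp : ∀ (η : ℝ) i, ∫ x, (|pd i g x| + η) ^ 2 ∂gauss n =
      (∫ x, pd i g x ^ 2 ∂gauss n) + 2 * η * (∫ x, |pd i g x| ∂gauss n) + η ^ 2 := by
    intro η i
    have : ∀ x, (|pd i g x| + η) ^ 2 = (pd i g x ^ 2 + 2 * η * |pd i g x|) + η ^ 2 := fun x => by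
      rw [← sq_abs (pd i g x)]; ring
    simp only [this]
    have hi3 := (hi1 i).const_mul (2 * η)
    have h1 := integral_add (hi2 i) hi3
    have h2 := integral_add (f := fun x => pd i g x ^ 2 + 2 * η * |pd i g x|) ((hi2 i).add hi3)
      (integrable_const (η ^ 2))
    rw [h2, h1, integral_const_mul]
    simp
  simp only [hexp] at key
  have hlim : Filter.Tendsto (fun η : ℝ => θ * ∑ i, ((∫ x, |pd i g x| ∂gauss n) + η) ^ 2 +
        4 * ∑ i, ((∫ x, pd i g x ^ 2 ∂gauss n) + 2 * η * (∫ x, |pd i g x| ∂gauss n) + η ^ 2))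
      (nhdsWithin 0 (Set.Ioi 0)) (nhds (θ * ∑ i, (∫ x, |pd i g x| ∂gauss n) ^ 2 +
        4 * ∑ i, ∫ x, pd i g x ^ 2 ∂gauss n)) := by
    apply tendsto_nhdsWithin_of_tendsto_nhds
    apply Continuous.tendsto'
    · fun_prop
    · simp
  exact ge_of_tendsto hlim (Filter.eventually_of_mem self_mem_nhdsWithin fun η hη => key η hη)

lemma gauss_absolutelyContinuous (n : ℕ) : gauss n ≪ volume := by
  induction n with
  | zero =>
    intro s hs
    rcases s.eq_empty_or_nonempty with rfl | h
    · simp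
    · rw [Subsingleton.eq_univ_of_nonempty h] at hs
      simp [volume_pi] at hs
  | succ n ih =>
    have h1 := measurePreserving_piFinSuccAbove (fun _ : Fin (n + 1) => gaussianReal 0 1) 0
    have h2 := volume_preserving_piFinSuccAbove (fun _ : Fin (n + 1) => ℝ) 0
    have h3 : (gaussianReal 0 1).prod (gauss n) ≪ (volume : Measure (ℝ × (Fin n → ℝ))) :=
      (gaussianReal_absolutelyContinuous 0 one_ne_zero).prod ih
    intro s hs
    rw [← h2.symm.map_eq, MeasurableEquiv.map_apply] at hs
    rw [gauss, ← h1.symm.map_eq, MeasurableEquiv.map_apply]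
    exact h3 hs

lemma integrable_exp_mul_abs_gaussianReal (c : ℝ) :
    Integrable (fun x => Real.exp (c * |x|)) (gaussianReal 0 1) := by
  refine ((integrable_exp_mul_gaussianReal (μ := 0) (v := 1) c).add
    (integrable_exp_mul_gaussianReal (μ := 0) (v := 1) (-c))).mono'
    (by fun_prop) (Filter.Eventually.of_forall fun x => ?_)
  rw [Real.norm_eq_abs, Real.abs_exp]
  simp only [Pi.add_apply]
  rcases abs_cases x with ⟨h, _⟩ | ⟨h, _⟩ <;> rw [h]
  · linarith [Real.exp_pos (-c * x)]
  · rw [mul_neg, ← neg_mul]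
    linarith [Real.exp_pos (c * x)]

lemma integrable_exp_mul_sum_abs (n : ℕ) (c : ℝ) :
    Integrable (fun x : Fin n → ℝ => Real.exp (c * ∑ i, |x i|)) (gauss n) := by
  have h : ∀ x : Fin n → ℝ, Real.exp (c * ∑ i, |x i|) = ∏ i, Real.exp (c * |x i|) := fun x => by
    rw [Finset.mul_sum, Real.exp_sum]
  simp only [h]
  exact Integrable.fintype_prod (f := fun _ x => Real.exp (c * |x|))
    fun _ => integrable_exp_mul_abs_gaussianReal c

lemma norm_le_sum_abs {n : ℕ} (x : Fin n → ℝ) : ‖x‖ ≤ ∑ i, |x i| :=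
  (pi_norm_le_iff_of_nonneg (Finset.sum_nonneg fun _ _ => abs_nonneg _)).2 fun i =>
    Finset.single_le_sum (f := fun i => |x i|) (fun _ _ => abs_nonneg _) (Finset.mem_univ i)

lemma abs_fderiv_apply_le {E : Type*} [NormedAddCommGroup E] [NormedSpace ℝ E] {f : E → ℝ}
    {x v : E} {K : ℝ} (hK : 0 ≤ K) (h : ∀ t : ℝ, |f (x + t • v) - f x| ≤ |t| * K) :
    |fderiv ℝ f x v| ≤ K := by
  by_cases hf : DifferentiableAt ℝ f x
  · have h1 := (hf.hasFDerivAt.hasLineDerivAt v).tendsto_slope_zero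
    refine le_of_tendsto h1.abs ?_
    filter_upwards [self_mem_nhdsWithin] with t ht
    rw [smul_eq_mul, abs_mul, abs_inv, inv_mul_le_iff₀ (abs_pos.2 ht)]
    simpa using h t
  · rw [fderiv_zero_of_not_differentiableAt hf]
    simpa using hK

lemma fderiv_apply_eq_sum_pd {n : ℕ} (f : (Fin n → ℝ) → ℝ) (x v : Fin n → ℝ) :
    fderiv ℝ f x v = ∑ i, v i * pd i f x := by
  conv_lhs => rw [pi_eq_sum_univ' v]
  simp [map_sum, pd, Pi.single]

lemma sum_abs_pd_le {n : ℕ} {f : (Fin n → ℝ) → ℝ} {a : ℝ} (ha : 0 ≤ a)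
    (hf : ∀ x y, |f x - f y| ≤ a * ‖x - y‖) (x : Fin n → ℝ) : ∑ i, |pd i f x| ≤ a := by
  have h1 := abs_fderiv_apply_le (f := f) (x := x) (v := fun i => (SignType.sign (pd i f x) : ℝ)) ha
    fun t => by
      refine (hf _ _).trans ?_
      rw [add_sub_cancel_left, norm_smul, Real.norm_eq_abs, mul_comm]
      have : ‖fun i => (SignType.sign (pd i f x) : ℝ)‖ ≤ 1 :=
        (pi_norm_le_iff_of_nonneg zero_le_one).2 fun i => by
          rcases SignType.sign (pd i f x) with _ | _ | _ <;> simp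
      nlinarith [abs_nonneg t, mul_nonneg (abs_nonneg t) ha]
  rw [fderiv_apply_eq_sum_pd] at h1
  simp only [sign_mul_self] at h1
  exact (le_abs_self _).trans h1

lemma sum_pd_sq_le {n : ℕ} {f : (Fin n → ℝ) → ℝ} {b : ℝ} (hb : 0 ≤ b)
    (hf : ∀ x y, |f x - f y| ≤ b * euclNorm (x - y)) (x : Fin n → ℝ) :
    ∑ i, pd i f x ^ 2 ≤ b ^ 2 := by
  have h0 : 0 ≤ ∑ i, pd i f x ^ 2 := Finset.sum_nonneg fun _ _ => sq_nonneg _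
  have h1 := abs_fderiv_apply_le (f := f) (x := x) (v := fun i => pd i f x)
    (mul_nonneg hb (Real.sqrt_nonneg (∑ i, pd i f x ^ 2)))
    fun t => by
      refine (hf _ _).trans_eq ?_
      have : ∑ i, ((x + (t • fun i => pd i f x) - x) i) ^ 2 = t ^ 2 * ∑ i, pd i f x ^ 2 := by
        rw [Finset.mul_sum]
        refine Finset.sum_congr rfl fun i _ => ?_
        simp [mul_pow]
      rw [euclNorm, this, Real.sqrt_mul (sq_nonneg t), Real.sqrt_sq_eq_abs]
      ring
  rw [fderiv_apply_eq_sum_pd] at h1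
  simp only [← sq] at h1
  rw [abs_of_nonneg h0] at h1
  set s := √(∑ i, pd i f x ^ 2) with hs
  have h2 : ∑ i, pd i f x ^ 2 = s ^ 2 := (Real.sq_sqrt h0).symm
  have h3 : 0 ≤ s := Real.sqrt_nonneg _
  rw [h2] at h1 ⊢
  have : s ≤ b := by
    by_contra! h
    nlinarith
  exact pow_le_pow_left₀ h3 this 2

lemma abs_pd_le {n : ℕ} {f : (Fin n → ℝ) → ℝ} {a : ℝ} (ha : 0 ≤ a)
    (hf : ∀ x y, |f x - f y| ≤ a * ‖x - y‖) (i : Fin n) (x : Fin n → ℝ) : |pd i f x| ≤ a :=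
  (Finset.single_le_sum (f := fun i => |pd i f x|) (fun _ _ => abs_nonneg _)
    (Finset.mem_univ i)).trans (sum_abs_pd_le ha hf x)

lemma lipschitzWith_of_abs_sub_le {n : ℕ} {f : (Fin n → ℝ) → ℝ} {a : ℝ}
    (hf : ∀ x y, |f x - f y| ≤ a * ‖x - y‖) : LipschitzWith a.toNNReal f :=
  LipschitzWith.of_dist_le' fun x y => by
    rw [dist_eq_norm, dist_eq_norm]
    exact hf x y

lemma abs_le_of_abs_sub_le {n : ℕ} {f : (Fin n → ℝ) → ℝ} {a : ℝ} (ha : 0 ≤ a)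
    (hf : ∀ x y, |f x - f y| ≤ a * ‖x - y‖) (x : Fin n → ℝ) :
    |f x| ≤ |f 0| + a * ∑ i, |x i| := by
  have h1 := hf x 0
  rw [sub_zero] at h1
  have h2 := abs_sub_abs_le_abs_sub (f x) (f 0)
  have h3 := mul_le_mul_of_nonneg_left (norm_le_sum_abs x) ha
  linarith

lemma exp_mul_le_of_abs_sub_le {n : ℕ} {f : (Fin n → ℝ) → ℝ} {a : ℝ} (ha : 0 ≤ a)
    (hf : ∀ x y, |f x - f y| ≤ a * ‖x - y‖) (s : ℝ) (x : Fin n → ℝ) :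
    Real.exp (s * f x) ≤ Real.exp (|s| * |f 0|) * Real.exp (|s| * a * ∑ i, |x i|) := by
  rw [← Real.exp_add]
  refine Real.exp_le_exp.2 ((le_abs_self _).trans ?_)
  rw [abs_mul]
  have := mul_le_mul_of_nonneg_left (abs_le_of_abs_sub_le ha hf x) (abs_nonneg s)
  linarith

lemma integrable_exp_mul_of_abs_sub_le {n : ℕ} {f : (Fin n → ℝ) → ℝ} {a : ℝ} (ha : 0 ≤ a)
    (hf : ∀ x y, |f x - f y| ≤ a * ‖x - y‖) (s : ℝ) :
    Integrable (fun x => Real.exp (s * f x)) (gauss n) := by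
  have hc := (lipschitzWith_of_abs_sub_le hf).continuous
  refine ((integrable_exp_mul_sum_abs n (|s| * a)).const_mul (Real.exp (|s| * |f 0|))).mono'
    (by fun_prop) (Filter.Eventually.of_forall fun x => ?_)
  rw [Real.norm_eq_abs, Real.abs_exp]
  exact exp_mul_le_of_abs_sub_le ha hf s x

lemma log_mul_varG_le_of_tendsto {n : ℕ} {θ L B c : ℝ} {G : ℕ → (Fin n → ℝ) → ℝ}
    {D : Fin n → ℕ → (Fin n → ℝ) → ℝ} {g : (Fin n → ℝ) → ℝ} {d : Fin n → (Fin n → ℝ) → ℝ}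
    (hmG : ∀ k, AEStronglyMeasurable (G k) (gauss n))
    (hmD : ∀ i k, AEStronglyMeasurable (D i k) (gauss n))
    (hG : ∀ k x, |G k x| ≤ B * Real.exp (c * ∑ i, |x i|))
    (hD : ∀ i k x, |D i k x| ≤ B * Real.exp (c * ∑ i, |x i|))
    (hGg : ∀ᵐ x ∂gauss n, Filter.Tendsto (fun k => G k x) Filter.atTop (nhds (g x)))
    (hDd : ∀ i, ∀ᵐ x ∂gauss n, Filter.Tendsto (fun k => D i k x) Filter.atTop (nhds (d i x)))
    (h : ∀ k, L * varG (G k) ≤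
      θ * ∑ i, (∫ x, |D i k x| ∂gauss n) ^ 2 + 4 * ∑ i, ∫ x, D i k x ^ 2 ∂gauss n) :
    L * varG g ≤
      θ * ∑ i, (∫ x, |d i x| ∂gauss n) ^ 2 + 4 * ∑ i, ∫ x, d i x ^ 2 ∂gauss n := by
  have hI : Integrable (fun x : Fin n → ℝ => B * Real.exp (c * ∑ i, |x i|)) (gauss n) :=
    (integrable_exp_mul_sum_abs n c).const_mul B
  have hI2 : Integrable (fun x : Fin n → ℝ => (B * Real.exp (c * ∑ i, |x i|)) ^ 2) (gauss n) := by
    refine ((integrable_exp_mul_sum_abs n (2 * c)).const_mul (B ^ 2)).congr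
      (Filter.Eventually.of_forall fun x => ?_)
    simp only [mul_pow, ← Real.exp_nat_mul]
    congr 2
    push_cast
    ring
  have hsq : ∀ {u v : ℝ}, |u| ≤ v → ‖u ^ 2‖ ≤ v ^ 2 := fun h => by
    rw [norm_pow, Real.norm_eq_abs]
    exact pow_le_pow_left₀ (abs_nonneg _) h 2
  have t1 : Filter.Tendsto (fun k => ∫ x, G k x ∂gauss n) Filter.atTop
      (nhds (∫ x, g x ∂gauss n)) :=
    tendsto_integral_of_dominated_convergence _ hmG hI
      (fun k => Filter.Eventually.of_forall (hG k)) hGg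
  have t2 : Filter.Tendsto (fun k => ∫ x, G k x ^ 2 ∂gauss n) Filter.atTop
      (nhds (∫ x, g x ^ 2 ∂gauss n)) :=
    tendsto_integral_of_dominated_convergence _ (fun k => (hmG k).pow 2) hI2
      (fun k => Filter.Eventually.of_forall fun x => hsq (hG k x))
      (hGg.mono fun x hx => hx.pow 2)
  have t3 : ∀ i, Filter.Tendsto (fun k => ∫ x, |D i k x| ∂gauss n) Filter.atTop
      (nhds (∫ x, |d i x| ∂gauss n)) := fun i =>
    tendsto_integral_of_dominated_convergence _ (fun k => (hmD i k).norm) hI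
      (fun k => Filter.Eventually.of_forall fun x => by simpa using hD i k x)
      ((hDd i).mono fun x hx => hx.abs)
  have t4 : ∀ i, Filter.Tendsto (fun k => ∫ x, D i k x ^ 2 ∂gauss n) Filter.atTop
      (nhds (∫ x, d i x ^ 2 ∂gauss n)) := fun i =>
    tendsto_integral_of_dominated_convergence _ (fun k => (hmD i k).pow 2) hI2
      (fun k => Filter.Eventually.of_forall fun x => hsq (hD i k x))
      ((hDd i).mono fun x hx => hx.pow 2)
  exact le_of_tendsto_of_tendsto' ((t2.sub (t1.pow 2)).const_mul L)
    (((tendsto_finsetSum _ fun i _ => (t3 i).pow 2).const_mul θ).add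
      ((tendsto_finsetSum _ fun i _ => t4 i).const_mul 4)) h

lemma pd_bump_mul_exp {n : ℕ} {χ f : (Fin n → ℝ) → ℝ} (hχ : Differentiable ℝ χ)
    (hf : Differentiable ℝ f) (r s : ℝ) (x : Fin n → ℝ) (i : Fin n) :
    pd i (fun y => χ (r • y) * Real.exp (s * f y)) x =
      r * pd i χ (r • x) * Real.exp (s * f x) +
        χ (r • x) * (s * pd i f x * Real.exp (s * f x)) := by
  have h1 : HasFDerivAt (fun y : Fin n → ℝ => r • y) (r • ContinuousLinearMap.id ℝ _) x :=
    (hasFDerivAt_id x).const_smul r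
  have h2 := (hχ (r • x)).hasFDerivAt.comp x h1
  have h3 := ((hf x).hasFDerivAt.const_mul s).exp
  have h4 := h2.mul h3
  unfold pd
  erw [h4.fderiv]
  simp
  ring

lemma log_mul_varG_exp_le_of_contDiff {n : ℕ} {θ : ℝ} (hθ : 0 < θ) {f : (Fin n → ℝ) → ℝ} {a : ℝ}
    (ha : 0 ≤ a) (hf : ∀ x y, |f x - f y| ≤ a * ‖x - y‖) (hc : ContDiff ℝ 1 f) (s : ℝ) :
    Real.log θ * varG (fun x => Real.exp (s * f x)) ≤
      θ * ∑ i, (∫ x, |s * pd i f x * Real.exp (s * f x)| ∂gauss n) ^ 2 +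
        4 * ∑ i, ∫ x, (s * pd i f x * Real.exp (s * f x)) ^ 2 ∂gauss n := by
  let χ : ContDiffBump (0 : Fin n → ℝ) := ⟨1, 2, one_pos, one_lt_two⟩
  have hχ : ContDiff ℝ 1 χ := χ.contDiff
  have hχd : Differentiable ℝ χ := hχ.differentiable (by norm_num)
  have hfd : Differentiable ℝ f := hc.differentiable (by norm_num)
  obtain ⟨K, hK⟩ := (χ.hasCompactSupport.fderiv ℝ).exists_bound_of_continuous
    (hχ.continuous_fderiv (by norm_num))
  have hK0 : 0 ≤ K := (norm_nonneg _).trans (hK 0)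
  have hpK : ∀ i x, |pd i χ x| ≤ K := fun i x => by
    have := (fderiv ℝ χ x).le_opNorm (Pi.single i 1)
    rw [Pi.norm_single, norm_one, mul_one] at this
    exact this.trans (hK x)
  let r : ℕ → ℝ := fun k => 1 / ((k : ℝ) + 1)
  have hr0 : ∀ k, 0 < r k := fun k => by positivity
  have hr1 : ∀ k, r k ≤ 1 := fun k => by
    rw [div_le_one (by positivity)]
    linarith [(Nat.cast_nonneg k : (0 : ℝ) ≤ k)]
  have hr : Filter.Tendsto r Filter.atTop (nhds 0) := tendsto_one_div_add_atTop_nhds_zero_nat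
  have hGc : ∀ k, ContDiff ℝ 1 fun y => χ (r k • y) * Real.exp (s * f y) := fun k =>
    (hχ.comp (contDiff_id.const_smul (r k))).mul (contDiff_const.mul hc).exp
  have hexp := exp_mul_le_of_abs_sub_le ha hf s
  have hχ1 : ∀ x, |χ x| ≤ 1 := fun x => by
    rw [abs_of_nonneg χ.nonneg]
    exact χ.le_one
  have hlim : ∀ x, Filter.Tendsto (fun k => χ (r k • x)) Filter.atTop (nhds 1) := fun x => by
    have h1 : Filter.Tendsto (fun k => r k • x) Filter.atTop (nhds 0) := by
      simpa using hr.smul_const x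
    have h2 := (hχ.continuous.tendsto 0).comp h1
    have h3 : χ 0 = 1 := χ.one_of_mem_closedBall (by simp [χ])
    rwa [h3] at h2
  refine log_mul_varG_le_of_tendsto (B := (1 + K + |s| * a) * Real.exp (|s| * |f 0|))
    (c := |s| * a)
    (G := fun k y => χ (r k • y) * Real.exp (s * f y))
    (D := fun i k => pd i fun y => χ (r k • y) * Real.exp (s * f y))
    (fun k => (hGc k).continuous.aestronglyMeasurable)
    (fun i k => (((hGc k).continuous_fderiv (by norm_num)).clm_apply
      continuous_const).aestronglyMeasurable) ?_ ?_ ?_ ?_ ?_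
  · intro k x
    rw [abs_mul, Real.abs_exp, mul_assoc]
    have h1 : 0 ≤ |s| * a := by positivity
    refine mul_le_mul ((hχ1 _).trans ?_) (hexp x) (Real.exp_pos _).le (by positivity)
    linarith
  · intro i k x
    rw [pd_bump_mul_exp hχd hfd, mul_assoc (1 + K + |s| * a), ← mul_assoc (χ (r k • x)),
      ← add_mul, abs_mul, Real.abs_exp]
    have h1 : |r k * pd i χ (r k • x)| ≤ K := by
      rw [abs_mul, abs_of_pos (hr0 k)]
      exact (mul_le_mul (hr1 k) (hpK i _) (abs_nonneg _) zero_le_one).trans_eq (one_mul K)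
    have h2 : |χ (r k • x) * (s * pd i f x)| ≤ |s| * a := by
      rw [abs_mul, abs_mul]
      exact (mul_le_mul (hχ1 _) (mul_le_mul_of_nonneg_left (abs_pd_le ha hf i x) (abs_nonneg s))
        (by positivity) zero_le_one).trans_eq (one_mul _)
    refine mul_le_mul ((abs_add_le _ _).trans ?_) (hexp x) (Real.exp_pos _).le (by positivity)
    linarith
  · refine Filter.Eventually.of_forall fun x => ?_
    simpa using (hlim x).mul_const (Real.exp (s * f x))
  · refine fun i => Filter.Eventually.of_forall fun x => ?_
    simp only [pd_bump_mul_exp hχd hfd]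
    have h1 : Filter.Tendsto (fun k => r k * pd i χ (r k • x)) Filter.atTop (nhds 0) := by
      refine squeeze_zero_norm (a := fun k => r k * K) (fun k => ?_) (by simpa using hr.mul_const K)
      rw [norm_mul, Real.norm_eq_abs, Real.norm_eq_abs, abs_of_pos (hr0 k)]
      exact mul_le_mul_of_nonneg_left (hpK i _) (hr0 k).le
    simpa using (h1.mul_const (Real.exp (s * f x))).add
      ((hlim x).mul_const (s * pd i f x * Real.exp (s * f x)))
  · intro k
    refine log_mul_varG_le_of_contDiff hθ (hGc k) (HasCompactSupport.mul_right ?_)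
    exact χ.hasCompactSupport.comp_homeomorph (Homeomorph.smulOfNeZero (r k) (hr0 k).ne')

open ContinuousLinearMap in
lemma pd_convolution_eq {n : ℕ} {f : (Fin n → ℝ) → ℝ} {C : NNReal} (hf : LipschitzWith C f)
    (φ : ContDiffBump (0 : Fin n → ℝ)) (i : Fin n) (x : Fin n → ℝ) :
    pd i (convolution (φ.normed volume) f (lsmul ℝ ℝ) volume) x =
      convolution (φ.normed volume) (pd i f) (lsmul ℝ ℝ) volume x := by
  have hφc : ContDiff ℝ 1 (φ.normed (volume : Measure (Fin n → ℝ))) := φ.contDiff_normed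
  have hφs := φ.hasCompactSupport_normed (μ := (volume : Measure (Fin n → ℝ)))
  have hd : ContDiff ℝ 1 (convolution (φ.normed volume) f (lsmul ℝ ℝ) volume) :=
    hφs.contDiff_convolution_left _ hφc hf.continuous.locallyIntegrable
  have hlim := ((((hd.differentiable (by norm_num)) x).hasFDerivAt.hasLineDerivAt
    (Pi.single i 1)).tendsto_slope_zero).mono_left
      (nhdsWithin_mono 0 fun t (ht : t ∈ Set.Ioi (0 : ℝ)) => (ne_of_gt ht : t ∈ ({0} : Set ℝ)ᶜ))
  have hgc : Continuous fun y => φ.normed volume (x - y) :=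
    hφc.continuous.comp (continuous_const.sub continuous_id)
  have hgs : HasCompactSupport fun y => φ.normed volume (x - y) :=
    hφs.comp_homeomorph (Homeomorph.subLeft x)
  have hlim2 := hf.integral_inv_smul_sub_mul_tendsto_integral_lineDeriv_mul (μ := volume)
    (hgc.integrable_of_hasCompactSupport hgs) (Pi.single i 1)
  have hint : ∀ z, Integrable (fun y => φ.normed volume (x - y) * f (y + z)) volume := fun z =>
    (hgc.mul (hf.continuous.comp (continuous_id.add continuous_const))).integrable_of_hasCompactSupport
      hgs.mul_right
  have heq : ∀ t : ℝ, t⁻¹ • (convolution (φ.normed volume) f (lsmul ℝ ℝ) volume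
      (x + t • Pi.single i 1) - convolution (φ.normed volume) f (lsmul ℝ ℝ) volume x) =
      ∫ y, (t⁻¹ • (f (y + t • Pi.single i 1) - f y)) * φ.normed volume (x - y) := by
    intro t
    have h1 : convolution (φ.normed volume) f (lsmul ℝ ℝ) volume (x + t • Pi.single i 1) =
        ∫ y, φ.normed volume (x - y) * f (y + t • Pi.single i 1) := by
      rw [convolution_lsmul,
        ← integral_sub_left_eq_self _ volume x]
      refine integral_congr_ae (Filter.Eventually.of_forall fun y => ?_)
      simp only [smul_eq_mul]
      congr 2
      abel
    have h2 : convolution (φ.normed volume) f (lsmul ℝ ℝ) volume x =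
        ∫ y, φ.normed volume (x - y) * f y := by
      rw [convolution_lsmul_swap]
      rfl
    rw [h1, h2, ← integral_sub (hint _) (by simpa using hint 0), smul_eq_mul, ← integral_const_mul]
    refine integral_congr_ae (Filter.Eventually.of_forall fun y => ?_)
    simp only [smul_eq_mul]
    ring
  simp only [heq] at hlim
  have h := tendsto_nhds_unique hlim hlim2
  rw [pd, h, convolution_lsmul_swap]
  refine integral_congr_ae ?_
  filter_upwards [hf.ae_differentiableAt (μ := volume)] with y hy
  rw [hy.lineDeriv_eq_fderiv, smul_eq_mul, mul_comm]
  rfl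

open ContinuousLinearMap in
lemma abs_convolution_sub_le {n : ℕ} {f : (Fin n → ℝ) → ℝ} {a : ℝ}
    (hf : ∀ x y, |f x - f y| ≤ a * ‖x - y‖) (φ : ContDiffBump (0 : Fin n → ℝ))
    (x y : Fin n → ℝ) :
    |convolution (φ.normed volume) f (lsmul ℝ ℝ) volume x -
      convolution (φ.normed volume) f (lsmul ℝ ℝ) volume y| ≤ a * ‖x - y‖ := by
  have hfc := (lipschitzWith_of_abs_sub_le hf).continuous
  have hφc : ContDiff ℝ 1 (φ.normed (volume : Measure (Fin n → ℝ))) := φ.contDiff_normed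
  have hφs := φ.hasCompactSupport_normed (μ := (volume : Measure (Fin n → ℝ)))
  have hint : ∀ z, Integrable (fun y => φ.normed volume y * f (z - y)) volume := fun z =>
    (hφc.continuous.mul (hfc.comp (continuous_const.sub continuous_id))).integrable_of_hasCompactSupport
      hφs.mul_right
  have hφi : Integrable (φ.normed (volume : Measure (Fin n → ℝ))) volume :=
    hφc.continuous.integrable_of_hasCompactSupport hφs
  rw [convolution_lsmul, convolution_lsmul]
  simp only [smul_eq_mul]
  rw [← integral_sub (hint x) (hint y)]
  have h1 : a * ‖x - y‖ = ∫ z, φ.normed volume z * (a * ‖x - y‖) := by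
    rw [integral_mul_const, φ.integral_normed, one_mul]
  rw [h1, ← Real.norm_eq_abs]
  refine norm_integral_le_of_norm_le (hφi.mul_const _) (Filter.Eventually.of_forall fun z => ?_)
  rw [← mul_sub, norm_mul, Real.norm_eq_abs, abs_of_nonneg (φ.nonneg_normed z)]
  refine mul_le_mul_of_nonneg_left ?_ (φ.nonneg_normed z)
  simpa using hf (x - z) (y - z)

open ContinuousLinearMap in
lemma log_mul_varG_exp_le {n : ℕ} {θ : ℝ} (hθ : 0 < θ) {f : (Fin n → ℝ) → ℝ} {a : ℝ}
    (ha : 0 ≤ a) (hf : ∀ x y, |f x - f y| ≤ a * ‖x - y‖) (s : ℝ) :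
    Real.log θ * varG (fun x => Real.exp (s * f x)) ≤
      θ * ∑ i, (∫ x, |s * pd i f x * Real.exp (s * f x)| ∂gauss n) ^ 2 +
        4 * ∑ i, ∫ x, (s * pd i f x * Real.exp (s * f x)) ^ 2 ∂gauss n := by
  have hL := lipschitzWith_of_abs_sub_le hf
  let r : ℕ → ℝ := fun k => 1 / ((k : ℝ) + 1)
  have hr0 : ∀ k, 0 < r k := fun k => by positivity
  have hr1 : ∀ k, r k ≤ 1 := fun k => by
    rw [div_le_one (by positivity)]
    linarith [(Nat.cast_nonneg k : (0 : ℝ) ≤ k)]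
  have hr : Filter.Tendsto r Filter.atTop (nhds 0) := tendsto_one_div_add_atTop_nhds_zero_nat
  let φ : ℕ → ContDiffBump (0 : Fin n → ℝ) := fun k =>
    ⟨r k / 2, r k, half_pos (hr0 k), half_lt_self (hr0 k)⟩
  let F : ℕ → (Fin n → ℝ) → ℝ := fun k =>
    convolution ((φ k).normed volume) f (lsmul ℝ ℝ) volume
  have hFL : ∀ k x y, |F k x - F k y| ≤ a * ‖x - y‖ := fun k => abs_convolution_sub_le hf (φ k)
  have hFc : ∀ k, ContDiff ℝ 1 (F k) := fun k =>
    (φ k).hasCompactSupport_normed.contDiff_convolution_left _ (φ k).contDiff_normed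
      hL.continuous.locallyIntegrable
  have hF0 : ∀ k, |F k 0| ≤ |f 0| + a := fun k => by
    have h1 : dist (F k 0) (f 0) ≤ a := (φ k).dist_normed_convolution_le
      hL.continuous.aestronglyMeasurable fun y hy => by
        rw [Real.dist_eq]
        refine (hf y 0).trans ?_
        rw [mem_ball_iff_norm] at hy
        exact mul_le_of_le_one_right ha (hy.le.trans (hr1 k))
    rw [Real.dist_eq] at h1
    linarith [abs_sub_abs_le_abs_sub (F k 0) (f 0)]
  have hexp : ∀ k x, Real.exp (s * F k x) ≤
      Real.exp (|s| * (|f 0| + a)) * Real.exp (|s| * a * ∑ i, |x i|) := fun k x => by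
    refine (exp_mul_le_of_abs_sub_le ha (hFL k) s x).trans ?_
    have := hF0 k
    gcongr
  have hFlim : ∀ x, Filter.Tendsto (fun k => F k x) Filter.atTop (nhds (f x)) :=
    ContDiffBump.convolution_tendsto_right_of_continuous hr hL.continuous
  have hElim : ∀ x, Filter.Tendsto (fun k => Real.exp (s * F k x)) Filter.atTop
      (nhds (Real.exp (s * f x))) := fun x => ((hFlim x).const_mul s).rexp
  have hpm : ∀ i, Measurable (pd i f) := fun i => measurable_fderiv_apply_const ℝ f _
  refine log_mul_varG_le_of_tendsto (B := (1 + |s| * a) * Real.exp (|s| * (|f 0| + a)))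
    (c := |s| * a)
    (G := fun k y => Real.exp (s * F k y))
    (D := fun i k y => s * pd i (F k) y * Real.exp (s * F k y))
    (fun k => ((hFc k).continuous.const_mul s).rexp.aestronglyMeasurable)
    (fun i k => (((((hFc k).continuous_fderiv (by norm_num)).clm_apply
      continuous_const).const_mul s).mul
        ((hFc k).continuous.const_mul s).rexp).aestronglyMeasurable) ?_ ?_
    (Filter.Eventually.of_forall hElim) ?_
    (fun k => log_mul_varG_exp_le_of_contDiff hθ ha (hFL k) (hFc k) s)
  · intro k x
    rw [Real.abs_exp, mul_assoc]
    refine (hexp k x).trans (le_mul_of_one_le_left (by positivity) ?_)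
    linarith [mul_nonneg (abs_nonneg s) ha]
  · intro i k x
    rw [abs_mul, Real.abs_exp, mul_assoc (1 + |s| * a), abs_mul]
    refine mul_le_mul ?_ (hexp k x) (Real.exp_pos _).le (by positivity)
    linarith [mul_le_mul_of_nonneg_left (abs_pd_le ha (hFL k) i x) (abs_nonneg s)]
  · intro i
    have hloc : LocallyIntegrable (pd i f) (volume : Measure (Fin n → ℝ)) :=
      (memLp_top_of_bound (hpm i).aestronglyMeasurable a
        (Filter.Eventually.of_forall fun x => abs_pd_le ha hf i x)).locallyIntegrable le_top
    have h1 := ContDiffBump.ae_convolution_tendsto_right_of_locallyIntegrable (φ := φ) (K := 2) hr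
      (Filter.Eventually.of_forall fun k => by simp only [φ]; linarith) hloc
    filter_upwards [(gauss_absolutelyContinuous n).ae_le h1] with x hx
    simp only [F, pd_convolution_eq hL]
    exact (hx.const_mul s).mul (hElim x)

lemma measurable_pd {n : ℕ} (i : Fin n) (f : (Fin n → ℝ) → ℝ) : Measurable (pd i f) :=
  measurable_fderiv_apply_const ℝ f _

lemma integrable_abs_pd_mul {n : ℕ} {f : (Fin n → ℝ) → ℝ} {a : ℝ} (ha : 0 ≤ a)
    (hf : ∀ x y, |f x - f y| ≤ a * ‖x - y‖) {w : (Fin n → ℝ) → ℝ}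
    (hw : Integrable w (gauss n)) (i : Fin n) :
    Integrable (fun x => |pd i f x| * w x) (gauss n) :=
  hw.bdd_mul (c := a) (measurable_pd i f).norm.aestronglyMeasurable
    (Filter.Eventually.of_forall fun x => by simpa using abs_pd_le ha hf i x)

lemma sum_integral_abs_pd_mul_sq_le {n : ℕ} {f : (Fin n → ℝ) → ℝ} {a b : ℝ} (ha : 0 ≤ a)
    (hb : 0 ≤ b) (hfa : ∀ x y, |f x - f y| ≤ a * ‖x - y‖)
    (hfb : ∀ x y, |f x - f y| ≤ b * euclNorm (x - y)) {w : (Fin n → ℝ) → ℝ}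
    (hw : Integrable w (gauss n)) (hw0 : ∀ x, 0 ≤ w x) :
    ∑ i, (∫ x, |pd i f x| * w x ∂gauss n) ^ 2 ≤ b ^ 2 * (∫ x, w x ∂gauss n) ^ 2 := by
  have hi := integrable_abs_pd_mul ha hfa hw
  set c : Fin n → ℝ := fun i => ∫ x, |pd i f x| * w x ∂gauss n with hc
  set W := ∫ x, w x ∂gauss n with hW
  have hW0 : 0 ≤ W := integral_nonneg hw0
  have h0 : 0 ≤ ∑ i, c i ^ 2 := Finset.sum_nonneg fun _ _ => sq_nonneg _
  set S := √(∑ i, c i ^ 2) with hS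
  have hS0 : 0 ≤ S := Real.sqrt_nonneg _
  have hS2 : ∑ i, c i ^ 2 = S ^ 2 := (Real.sq_sqrt h0).symm
  have h1 : ∑ i, c i ^ 2 = ∫ x, ∑ i, c i * (|pd i f x| * w x) ∂gauss n := by
    rw [integral_finsetSum _ fun i _ => (hi i).const_mul (c i)]
    refine Finset.sum_congr rfl fun i _ => ?_
    rw [integral_const_mul, sq]
  have h2 : ∫ x, ∑ i, c i * (|pd i f x| * w x) ∂gauss n ≤ ∫ x, S * b * w x ∂gauss n := by
    refine integral_mono (integrable_finsetSum _ fun i _ => (hi i).const_mul (c i))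
      (hw.const_mul _) fun x => ?_
    have h3 := Real.sum_mul_le_sqrt_mul_sqrt Finset.univ c fun i => |pd i f x|
    simp only [sq_abs] at h3
    have h4 : √(∑ i, pd i f x ^ 2) ≤ b := by
      rw [← Real.sqrt_sq hb]
      exact Real.sqrt_le_sqrt (sum_pd_sq_le hb hfb x)
    simp only [← mul_assoc]
    rw [← Finset.sum_mul]
    exact mul_le_mul_of_nonneg_right (h3.trans (mul_le_mul_of_nonneg_left h4 hS0)) (hw0 x)
  rw [integral_const_mul, ← h1, hS2] at h2
  have h5 : S ≤ b * W := by
    by_contra! h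
    have : 0 ≤ b * W := mul_nonneg hb hW0
    nlinarith
  rw [hS2, ← mul_pow]
  exact pow_le_pow_left₀ hS0 h5 2

lemma integrable_exp_sq_of_abs_sub_le {n : ℕ} {f : (Fin n → ℝ) → ℝ} {a : ℝ} (ha : 0 ≤ a)
    (hf : ∀ x y, |f x - f y| ≤ a * ‖x - y‖) (s : ℝ) :
    Integrable (fun x => Real.exp (s * f x) ^ 2) (gauss n) :=
  (integrable_exp_mul_of_abs_sub_le ha hf (2 * s)).congr
    (Filter.Eventually.of_forall fun x => by
      simp only [← Real.exp_nat_mul]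
      congr 1
      push_cast
      ring)

lemma integral_exp_sq_eq_mgf {n : ℕ} (f : (Fin n → ℝ) → ℝ) (s : ℝ) :
    ∫ x, Real.exp (s * f x) ^ 2 ∂gauss n = mgf f (gauss n) (2 * s) :=
  integral_congr_ae (Filter.Eventually.of_forall fun x => by
    simp only [← Real.exp_nat_mul]
    congr 1
    push_cast
    ring)

lemma varG_exp_eq {n : ℕ} (f : (Fin n → ℝ) → ℝ) (s : ℝ) :
    varG (fun x => Real.exp (s * f x)) = mgf f (gauss n) (2 * s) - mgf f (gauss n) s ^ 2 := by
  rw [varG, integral_exp_sq_eq_mgf]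
  rfl

lemma mgf_sq_le_mgf_two_mul {n : ℕ} {f : (Fin n → ℝ) → ℝ} {a : ℝ} (ha : 0 ≤ a)
    (hf : ∀ x y, |f x - f y| ≤ a * ‖x - y‖) (s : ℝ) :
    mgf f (gauss n) s ^ 2 ≤ mgf f (gauss n) (2 * s) := by
  have h1 := integrable_exp_mul_of_abs_sub_le ha hf s
  have h2 : MemLp (fun x => Real.exp (s * f x)) 2 (gauss n) :=
    (memLp_two_iff_integrable_sq h1.aestronglyMeasurable).2
      (integrable_exp_sq_of_abs_sub_le ha hf s)
  have h3 := variance_nonneg (fun x => Real.exp (s * f x)) (gauss n)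
  rw [variance_eq_sub h2] at h3
  rw [← integral_exp_sq_eq_mgf]
  exact sub_nonneg.1 h3

lemma log_mul_mgf_sub_le {n : ℕ} {θ : ℝ} (hθ : 0 < θ) {f : (Fin n → ℝ) → ℝ} {a b : ℝ}
    (ha : 0 ≤ a) (hb : 0 ≤ b) (hfa : ∀ x y, |f x - f y| ≤ a * ‖x - y‖)
    (hfb : ∀ x y, |f x - f y| ≤ b * euclNorm (x - y)) (s : ℝ) :
    Real.log θ * (mgf f (gauss n) (2 * s) - mgf f (gauss n) s ^ 2) ≤
      s ^ 2 * (θ * ∑ i, (∫ x, |pd i f x| * Real.exp (s * f x) ∂gauss n) ^ 2 +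
        4 * b ^ 2 * mgf f (gauss n) (2 * s)) := by
  have h := log_mul_varG_exp_le hθ ha hfa s
  rw [varG_exp_eq] at h
  have h1 : ∀ i, (∫ x, |s * pd i f x * Real.exp (s * f x)| ∂gauss n) ^ 2 =
      s ^ 2 * (∫ x, |pd i f x| * Real.exp (s * f x) ∂gauss n) ^ 2 := fun i => by
    simp only [abs_mul, Real.abs_exp, mul_assoc]
    rw [integral_const_mul, mul_pow, sq_abs]
  have h2 : ∑ i, ∫ x, (s * pd i f x * Real.exp (s * f x)) ^ 2 ∂gauss n ≤
      s ^ 2 * (b ^ 2 * mgf f (gauss n) (2 * s)) := by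
    have hi : ∀ i, Integrable (fun x => (s * pd i f x * Real.exp (s * f x)) ^ 2) (gauss n) :=
      fun i => by
        simp only [mul_pow _ (Real.exp _)]
        refine (integrable_exp_sq_of_abs_sub_le ha hfa s).bdd_mul (c := (|s| * a) ^ 2)
          (((measurable_pd i f).const_mul s).pow_const 2).aestronglyMeasurable
          (Filter.Eventually.of_forall fun x => ?_)
        rw [norm_pow, Real.norm_eq_abs, abs_mul]
        exact pow_le_pow_left₀ (by positivity)
          (mul_le_mul_of_nonneg_left (abs_pd_le ha hfa i x) (abs_nonneg s)) 2
    rw [← integral_finsetSum _ fun i _ => hi i, ← integral_exp_sq_eq_mgf, ← integral_const_mul,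
      ← integral_const_mul]
    refine integral_mono (integrable_finsetSum _ fun i _ => hi i)
      (((integrable_exp_sq_of_abs_sub_le ha hfa s).const_mul _).const_mul _) fun x => ?_
    simp only [mul_pow, mul_assoc]
    rw [← Finset.mul_sum, ← Finset.sum_mul]
    have := sum_pd_sq_le hb hfb x
    gcongr
  simp only [h1] at h
  rw [← Finset.mul_sum] at h
  linarith

lemma mgf_two_mul_le {n : ℕ} {f : (Fin n → ℝ) → ℝ} {a b : ℝ}
    (ha : 0 ≤ a) (hb : 0 ≤ b) (hfa : ∀ x y, |f x - f y| ≤ a * ‖x - y‖)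
    (hfb : ∀ x y, |f x - f y| ≤ b * euclNorm (x - y)) (s : ℝ) :
    mgf f (gauss n) (2 * s) ≤ Real.exp (8 * b ^ 2 * s ^ 2) * mgf f (gauss n) s ^ 2 := by
  set u : ℝ := 4 * (s ^ 2 * b ^ 2) with hu
  have hu0 : 0 ≤ u := by positivity
  have h := log_mul_mgf_sub_le (Real.exp_pos (1 + u)) ha hb hfa hfb s
  have h1 := sum_integral_abs_pd_mul_sq_le ha hb hfa hfb
    (integrable_exp_mul_of_abs_sub_le ha hfa s) fun x => (Real.exp_pos _).le
  have hP : (∫ x, Real.exp (s * f x) ∂gauss n) = mgf f (gauss n) s := rfl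
  rw [hP] at h1
  rw [Real.log_exp] at h
  set P := mgf f (gauss n) s ^ 2 with hPd
  set M := mgf f (gauss n) (2 * s) with hM
  have hP0 : 0 ≤ P := sq_nonneg _
  have h2 := mul_le_mul_of_nonneg_left h1 (mul_nonneg (sq_nonneg s) (Real.exp_pos (1 + u)).le)
  have h3 : M ≤ (1 + u + Real.exp (1 + u) * u / 4) * P := by
    rw [hu] at h h2 ⊢
    linarith
  refine h3.trans (mul_le_mul_of_nonneg_right ?_ hP0)
  have h4 : 8 * b ^ 2 * s ^ 2 = u + u := by rw [hu]; ring
  rw [h4, Real.exp_add, Real.exp_add]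
  have h5 := Real.add_one_le_exp u
  have h6 := Real.exp_one_lt_three
  have h7 : Real.exp 1 * (Real.exp u * u) ≤ 4 * (Real.exp u * u) :=
    mul_le_mul_of_nonneg_right (by linarith) (by positivity)
  have h8 := mul_le_mul_of_nonneg_left h5 (Real.exp_pos u).le
  linarith

lemma le_one_of_le_sq {χ : ℝ → ℝ} {r K : ℝ} (hr : 0 < r) (h0 : ∀ x, 0 ≤ χ x)
    (h2 : ∀ x, 0 < x → x ≤ r / 2 → χ (2 * x) ≤ χ x ^ 2)
    (hK : ∀ x, 0 < x → x ≤ 1 → χ x ≤ 1 + K * x ^ 2) : χ r ≤ 1 := by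
  have h1 : ∀ k : ℕ, χ r ≤ χ (r / 2 ^ k) ^ 2 ^ k := by
    intro k
    induction k with
    | zero => simp
    | succ k ih =>
      have h3 := h2 (r / 2 ^ (k + 1)) (by positivity) (by
        have : (1 : ℝ) ≤ 2 ^ k := one_le_pow₀ one_le_two
        rw [pow_succ, ← div_div]
        exact div_le_div_of_nonneg_right (div_le_self hr.le this) zero_le_two)
      have h4 : 2 * (r / 2 ^ (k + 1)) = r / 2 ^ k := by
        rw [pow_succ]; field_simp
      rw [h4] at h3
      refine ih.trans ((pow_le_pow_left₀ (h0 _) h3 _).trans_eq ?_)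
      rw [← pow_mul, ← pow_succ']
  have hlim : Filter.Tendsto (fun k : ℕ => Real.exp (K * r ^ 2 * (1 / 2) ^ k)) Filter.atTop
      (nhds 1) := by
    have h3 : Filter.Tendsto (fun k : ℕ => (1 / 2 : ℝ) ^ k) Filter.atTop (nhds 0) :=
      tendsto_pow_atTop_nhds_zero_of_lt_one (by norm_num) (by norm_num)
    simpa using (h3.const_mul (K * r ^ 2)).rexp
  have hsmall : ∀ᶠ k : ℕ in Filter.atTop, r / 2 ^ k ≤ 1 := by
    have h3 : Filter.Tendsto (fun k : ℕ => (2 : ℝ) ^ k) Filter.atTop Filter.atTop :=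
      tendsto_pow_atTop_atTop_of_one_lt one_lt_two
    filter_upwards [h3.eventually_ge_atTop r] with k hk
    exact (div_le_one (by positivity)).2 hk
  refine ge_of_tendsto hlim ?_
  filter_upwards [hsmall] with k hk
  refine (h1 k).trans ?_
  have h3 : χ (r / 2 ^ k) ≤ Real.exp (K * (r / 2 ^ k) ^ 2) :=
    (hK _ (by positivity) hk).trans (by linarith [Real.add_one_le_exp (K * (r / 2 ^ k) ^ 2)])
  refine (pow_le_pow_left₀ (h0 _) h3 _).trans_eq ?_
  rw [← Real.exp_nat_mul]
  congr 1
  push_cast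
  rw [one_div, inv_pow]
  field_simp

lemma exp_le_one_add_add_sq_mul_exp_abs (x : ℝ) :
    Real.exp x ≤ 1 + x + x ^ 2 * Real.exp |x| := by
  have h0 : 1 ≤ Real.exp |x| := Real.one_le_exp (abs_nonneg x)
  rcases le_or_gt |x| 1 with h | h
  · have := (abs_le.1 (Real.abs_exp_sub_one_sub_id_le h)).2
    nlinarith [sq_nonneg x]
  · rcases lt_abs.1 h with h | h
    · rw [abs_of_pos (by linarith)] at h0 ⊢
      nlinarith [mul_le_mul_of_nonneg_right (one_le_pow₀ h.le : 1 ≤ x ^ 2) (Real.exp_pos x).le]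
    · have h1 : Real.exp x ≤ 1 := Real.exp_le_one_iff.2 (by linarith)
      nlinarith [sq_nonneg x]

lemma sq_mul_exp_abs_le (y : ℝ) :
    y ^ 2 * Real.exp |y| ≤ 2 * (Real.exp (2 * y) + Real.exp (-2 * y)) := by
  have h1 := Real.quadratic_le_exp_of_nonneg (abs_nonneg y)
  rw [sq_abs] at h1
  have h2 : y ^ 2 ≤ 2 * Real.exp |y| := by linarith [abs_nonneg y]
  have h3 : Real.exp |y| * Real.exp |y| ≤ Real.exp (2 * y) + Real.exp (-2 * y) := by
    rw [← Real.exp_add, ← two_mul]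
    rcases abs_cases y with ⟨h, _⟩ | ⟨h, _⟩ <;> rw [h]
    · linarith [Real.exp_pos (-2 * y)]
    · rw [mul_neg, ← neg_mul]
      linarith [Real.exp_pos (2 * y)]
  have := mul_le_mul_of_nonneg_right h2 (Real.exp_pos |y|).le
  linarith

lemma mgf_le_one_add_mul_sq {n : ℕ} {f : (Fin n → ℝ) → ℝ} {a : ℝ} (ha : 0 ≤ a)
    (hf : ∀ x y, |f x - f y| ≤ a * ‖x - y‖) (hfi : Integrable f (gauss n))
    (hm : ∫ x, f x ∂gauss n = 0) {ε : ℝ} (h0 : 0 < ε) (h1 : ε ≤ 1) :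
    mgf f (gauss n) ε ≤ 1 + 2 * (mgf f (gauss n) 2 + mgf f (gauss n) (-2)) * ε ^ 2 := by
  have hI := integrable_exp_mul_of_abs_sub_le ha hf
  have h3 : mgf f (gauss n) ε ≤ ∫ x, ((1 + ε * f x) +
      2 * ε ^ 2 * (Real.exp (2 * f x) + Real.exp (-2 * f x))) ∂gauss n := by
    refine integral_mono (hI ε) (((integrable_const _).add (hfi.const_mul _)).add
      (((hI 2).add (hI (-2))).const_mul _)) fun x => ?_
    have h4 := exp_le_one_add_add_sq_mul_exp_abs (ε * f x)
    have h5 := sq_mul_exp_abs_le (f x)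
    have h6 : Real.exp |ε * f x| ≤ Real.exp |f x| := by
      rw [Real.exp_le_exp, abs_mul, abs_of_pos h0]
      exact mul_le_of_le_one_left (abs_nonneg _) h1
    have h7 := mul_le_mul_of_nonneg_left h6 (sq_nonneg (ε * f x))
    have h8 := mul_le_mul_of_nonneg_left h5 (sq_nonneg ε)
    rw [mul_pow] at h4 h7
    simp only
    linarith
  refine h3.trans_eq ?_
  have h9 : Integrable (fun x => 2 * ε ^ 2 * (Real.exp (2 * f x) + Real.exp (-2 * f x)))
      (gauss n) := ((hI 2).add (hI (-2))).const_mul _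
  rw [integral_add (f := fun x => 1 + ε * f x) ((integrable_const _).add (hfi.const_mul _)) h9,
    integral_add (integrable_const _) (hfi.const_mul _),
    integral_const_mul, integral_const_mul, integral_add (hI 2) (hI (-2)), hm]
  simp only [integral_const, probReal_univ, smul_eq_mul, mgf]
  ring

lemma one_le_mgf {n : ℕ} {f : (Fin n → ℝ) → ℝ} {a : ℝ} (ha : 0 ≤ a)
    (hf : ∀ x y, |f x - f y| ≤ a * ‖x - y‖) (hfi : Integrable f (gauss n))
    (hm : ∫ x, f x ∂gauss n = 0) (s : ℝ) : 1 ≤ mgf f (gauss n) s := by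
  have h : ∫ x, (s * f x + 1) ∂gauss n ≤ mgf f (gauss n) s :=
    integral_mono ((hfi.const_mul s).add (integrable_const _))
      (integrable_exp_mul_of_abs_sub_le ha hf s) fun x => Real.add_one_le_exp _
  rw [integral_add (hfi.const_mul s) (integrable_const _), integral_const_mul, hm] at h
  simpa using h

lemma mgf_le_exp_of_mgf_two_mul_le {n : ℕ} {f : (Fin n → ℝ) → ℝ} {a : ℝ} (ha : 0 ≤ a)
    (hf : ∀ x y, |f x - f y| ≤ a * ‖x - y‖) (hfi : Integrable f (gauss n))
    (hm : ∫ x, f x ∂gauss n = 0) {B r : ℝ} (hB : 0 ≤ B) (hr : 0 < r)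
    (h : ∀ x, 0 < x → x ≤ r / 2 →
      mgf f (gauss n) (2 * x) ≤ Real.exp (B * x ^ 2) * mgf f (gauss n) x ^ 2) :
    mgf f (gauss n) r ≤ Real.exp (B * r ^ 2 / 2) := by
  have h1 := le_one_of_le_sq (χ := fun x => mgf f (gauss n) x * Real.exp (-(B * x ^ 2 / 2)))
    (K := 2 * (mgf f (gauss n) 2 + mgf f (gauss n) (-2))) hr
    (fun x => mul_nonneg mgf_nonneg (Real.exp_pos _).le) (fun x hx0 hx => by
      have h2 := mul_le_mul_of_nonneg_right (h x hx0 hx)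
        (Real.exp_pos (-(B * (2 * x) ^ 2 / 2))).le
      refine h2.trans_eq ?_
      rw [mul_pow (mgf f (gauss n) x), ← Real.exp_nat_mul, mul_right_comm, ← Real.exp_add, mul_comm]
      congr 2
      push_cast
      ring)
    fun x hx0 hx => by
      refine (mul_le_of_le_one_right mgf_nonneg ?_).trans
        (mgf_le_one_add_mul_sq ha hf hfi hm hx0 hx)
      exact Real.exp_le_one_iff.2 (neg_nonpos.2 (by positivity))
  simp only [Real.exp_neg] at h1
  rwa [mul_inv_le_iff₀ (Real.exp_pos _), one_mul] at h1

lemma mgf_le_exp_sq {n : ℕ} {f : (Fin n → ℝ) → ℝ} {a b : ℝ}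
    (ha : 0 ≤ a) (hb : 0 ≤ b) (hfa : ∀ x y, |f x - f y| ≤ a * ‖x - y‖)
    (hfb : ∀ x y, |f x - f y| ≤ b * euclNorm (x - y)) (hfi : Integrable f (gauss n))
    (hm : ∫ x, f x ∂gauss n = 0) {s : ℝ} (hs : 0 ≤ s) :
    mgf f (gauss n) s ≤ Real.exp (4 * b ^ 2 * s ^ 2) := by
  rcases hs.eq_or_lt with rfl | hs
  · simp
  · refine (mgf_le_exp_of_mgf_two_mul_le ha hfa hfi hm (B := 8 * b ^ 2) (by positivity) hs
      fun x _ _ => mgf_two_mul_le ha hb hfa hfb x).trans_eq ?_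
    congr 1
    ring

lemma sum_integral_abs_pd_mul_exp_sq_le {n : ℕ} {f : (Fin n → ℝ) → ℝ} {a b A U : ℝ} (ha : 0 ≤ a)
    (hb : 0 ≤ b) (hA : 0 ≤ A) (hU : 0 < U) (hfa : ∀ x y, |f x - f y| ≤ a * ‖x - y‖)
    (hfb : ∀ x y, |f x - f y| ≤ b * euclNorm (x - y))
    (hfA : ∀ i : Fin n, ∫ x, |pd i f x| ∂gauss n ≤ A) (s : ℝ) :
    ∑ i, (∫ x, |pd i f x| * Real.exp (s * f x) ∂gauss n) ^ 2 ≤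
      2 * (U * (a * A)) + 2 * (b ^ 2 * mgf f (gauss n) (2 * s) ^ 2 / U) := by
  have hw2 := integrable_exp_sq_of_abs_sub_le ha hfa s
  have hT : 0 < √U := Real.sqrt_pos.2 hU
  have hT2 : √U ^ 2 = U := Real.sq_sqrt hU.le
  have hp : ∀ i, Integrable (fun x => |pd i f x|) (gauss n) := fun i => by
    simpa using integrable_abs_pd_mul ha hfa (integrable_const (1 : ℝ)) i
  have hq := integrable_abs_pd_mul ha hfa hw2
  have h1 : ∀ i, (∫ x, |pd i f x| * Real.exp (s * f x) ∂gauss n) ≤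
      √U * (∫ x, |pd i f x| ∂gauss n) +
        (√U)⁻¹ * ∫ x, |pd i f x| * Real.exp (s * f x) ^ 2 ∂gauss n := fun i => by
    rw [← integral_const_mul, ← integral_const_mul,
      ← integral_add ((hp i).const_mul _) ((hq i).const_mul _)]
    refine integral_mono
      (integrable_abs_pd_mul ha hfa (integrable_exp_mul_of_abs_sub_le ha hfa s) i)
      (((hp i).const_mul _).add ((hq i).const_mul _)) fun x => ?_
    have h2 : Real.exp (s * f x) ≤ √U + (√U)⁻¹ * Real.exp (s * f x) ^ 2 := by
      have h3 := sq_nonneg (Real.exp (s * f x) - √U)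
      have h4 := mul_pos hT (Real.exp_pos (s * f x))
      rw [← sub_nonneg]
      have h5 : √U + (√U)⁻¹ * Real.exp (s * f x) ^ 2 - Real.exp (s * f x) =
          (√U)⁻¹ * (√U ^ 2 + Real.exp (s * f x) ^ 2 - √U * Real.exp (s * f x)) := by
        field_simp
      rw [h5]
      refine mul_nonneg (inv_nonneg.2 hT.le) ?_
      linarith
    have h6 := mul_le_mul_of_nonneg_left h2 (abs_nonneg (pd i f x))
    simp only
    linarith
  have h2 : ∀ i, (∫ x, |pd i f x| * Real.exp (s * f x) ∂gauss n) ^ 2 ≤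
      2 * (U * (∫ x, |pd i f x| ∂gauss n) ^ 2) +
        2 * (U⁻¹ * (∫ x, |pd i f x| * Real.exp (s * f x) ^ 2 ∂gauss n) ^ 2) := fun i => by
    refine (pow_le_pow_left₀ (integral_nonneg fun x => by positivity) (h1 i) 2).trans
      (add_sq_le.trans_eq ?_)
    rw [mul_pow, mul_pow, inv_pow, hT2]
    ring
  refine (Finset.sum_le_sum fun i _ => h2 i).trans ?_
  rw [Finset.sum_add_distrib, ← Finset.mul_sum, ← Finset.mul_sum, ← Finset.mul_sum,
    ← Finset.mul_sum]
  have h3 : ∑ i, (∫ x, |pd i f x| ∂gauss n) ^ 2 ≤ a * A := by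
    have h4 : ∑ i, ∫ x, |pd i f x| ∂gauss n ≤ a := by
      rw [← integral_finsetSum _ fun i _ => hp i]
      refine (integral_mono (integrable_finsetSum _ fun i _ => hp i) (integrable_const a)
        fun x => sum_abs_pd_le ha hfa x).trans_eq ?_
      simp
    refine le_trans ?_ (mul_le_mul_of_nonneg_right h4 hA)
    rw [Finset.sum_mul]
    refine Finset.sum_le_sum fun i _ => ?_
    rw [sq]
    exact mul_le_mul_of_nonneg_left (hfA i) (integral_nonneg fun x => abs_nonneg _)
  have h5 := sum_integral_abs_pd_mul_sq_le ha hb hfa hfb hw2 fun x => sq_nonneg _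
  rw [integral_exp_sq_eq_mgf] at h5
  rw [div_eq_inv_mul]
  gcongr

lemma mgf_sub_sq_le {n : ℕ} {f : (Fin n → ℝ) → ℝ} {a b A : ℝ} (ha : 0 < a)
    (hb : 0 < b) (hA : 0 < A) (hfa : ∀ x y, |f x - f y| ≤ a * ‖x - y‖)
    (hfb : ∀ x y, |f x - f y| ≤ b * euclNorm (x - y))
    (hfA : ∀ i : Fin n, ∫ x, |pd i f x| ∂gauss n ≤ A) (hfi : Integrable f (gauss n))
    (hm : ∫ x, f x ∂gauss n = 0) {s : ℝ} (hs : 0 < s) :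
    mgf f (gauss n) (2 * s) - mgf f (gauss n) s ^ 2 ≤
      256 * s ^ 2 * b ^ 2 / Real.log (Real.exp 1 + b ^ 2 / (a * A)) *
        mgf f (gauss n) (2 * s) := by
  set M := mgf f (gauss n) (2 * s) with hMd
  have hM1 : 1 ≤ M := one_le_mgf ha.le hfa hfi hm _
  have hPM : mgf f (gauss n) s ^ 2 ≤ M := mgf_sq_le_mgf_two_mul ha.le hfa s
  have hP0 : 0 ≤ mgf f (gauss n) s ^ 2 := sq_nonneg _
  have haA : 0 < a * A := mul_pos ha hA
  set R := b ^ 2 / (a * A) with hR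
  have hR0 : 0 < R := by positivity
  have hRaA : R * (a * A) = b ^ 2 := div_mul_cancel₀ _ haA.ne'
  set L := Real.log (Real.exp 1 + R) with hL
  have hQ0 : 0 < Real.exp 1 + R := by positivity
  have hexpL : Real.exp L = Real.exp 1 + R := Real.exp_log hQ0
  have hL1 : 1 ≤ L := by
    rw [hL, Real.le_log_iff_exp_le hQ0]
    linarith
  have hL0 : 0 < L := by linarith
  have he : Real.exp 1 < 3 := Real.exp_one_lt_three
  set S := s ^ 2 * b ^ 2 with hS
  have hS0 : 0 < S := by positivity
  have hrw : 256 * s ^ 2 * b ^ 2 / L * M = 256 * S * M / L := by rw [hS]; ring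
  rw [hrw, le_div_iff₀ hL0]
  have hV0 : 0 ≤ M - mgf f (gauss n) s ^ 2 := sub_nonneg.2 hPM
  rcases lt_or_ge (L / 256) S with hSL | hSL
  · have h1 : (M - mgf f (gauss n) s ^ 2) * L ≤ M * L :=
      mul_le_mul_of_nonneg_right (by linarith) hL0.le
    have h2 : M * L ≤ M * (256 * S) := mul_le_mul_of_nonneg_left (by linarith) (by linarith)
    linarith
  rcases le_or_gt 1 R with hR1 | hR1
  · have h1 := log_mul_mgf_sub_le (Real.exp_pos (L / 4)) ha.le hb.le hfa hfb s
    have h2 := sum_integral_abs_pd_mul_exp_sq_le ha.le hb.le hA.le (Real.exp_pos (L / 2)) hfa hfb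
      hfA s
    have h3 : M ≤ Real.exp (L / 4) := by
      refine (mgf_le_exp_sq ha.le hb.le hfa hfb hfi hm (by positivity)).trans
        (Real.exp_le_exp.2 ?_)
      have : 4 * b ^ 2 * (2 * s) ^ 2 = 16 * S := by rw [hS]; ring
      rw [this]
      linarith
    rw [Real.log_exp, ← hMd] at h1
    rw [← hMd] at h2
    have h4 := mul_le_mul_of_nonneg_left h2 (Real.exp_pos (L / 4)).le
    have h5 : Real.exp (L / 4) * (2 * (Real.exp (L / 2) * (a * A))) ≤ 8 * (b ^ 2 * M) := by
      have h6 : Real.exp (L / 4) * Real.exp (L / 2) ≤ 4 * R := by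
        rw [← Real.exp_add]
        calc Real.exp (L / 4 + L / 2) ≤ Real.exp L := Real.exp_le_exp.2 (by linarith)
          _ ≤ 4 * R := by rw [hexpL]; linarith
      have h7 := mul_le_mul_of_nonneg_right h6 haA.le
      have h8 : b ^ 2 * 1 ≤ b ^ 2 * M := mul_le_mul_of_nonneg_left hM1 (sq_nonneg b)
      nlinarith
    have h6 : Real.exp (L / 4) * (2 * (b ^ 2 * M ^ 2 / Real.exp (L / 2))) ≤ 2 * (b ^ 2 * M) := by
      have h7 : Real.exp (L / 2) = Real.exp (L / 4) * Real.exp (L / 4) := by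
        rw [← Real.exp_add]; congr 1; ring
      have h8 : Real.exp (L / 4) * (2 * (b ^ 2 * M ^ 2 / Real.exp (L / 2))) =
          2 * (b ^ 2 * M) * (M / Real.exp (L / 4)) := by
        rw [h7]; field_simp
      rw [h8]
      exact mul_le_of_le_one_right (by positivity) ((div_le_one (Real.exp_pos _)).2 h3)
    have h7 : L / 4 * (M - mgf f (gauss n) s ^ 2) ≤ s ^ 2 * (14 * (b ^ 2 * M)) :=
      h1.trans (mul_le_mul_of_nonneg_left (by linarith) (sq_nonneg s))
    have h8 : s ^ 2 * (14 * (b ^ 2 * M)) = 14 * (S * M) := by rw [hS]; ring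
    have h9 : 0 ≤ S * M := by positivity
    linarith
  · have h1 := log_mul_mgf_sub_le (Real.exp_pos 1) ha.le hb.le hfa hfb s
    have h2 := sum_integral_abs_pd_mul_sq_le ha.le hb.le hfa hfb
      (integrable_exp_mul_of_abs_sub_le ha.le hfa s) fun x => (Real.exp_pos _).le
    have hP : (∫ x, Real.exp (s * f x) ∂gauss n) = mgf f (gauss n) s := rfl
    rw [hP] at h2
    rw [Real.log_exp, one_mul, ← hMd] at h1
    have h3 : b ^ 2 * mgf f (gauss n) s ^ 2 ≤ b ^ 2 * M :=
      mul_le_mul_of_nonneg_left hPM (sq_nonneg b)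
    have h4 := mul_le_mul he.le (h2.trans h3) (Finset.sum_nonneg fun i _ => sq_nonneg _)
      (by norm_num)
    have h5 : M - mgf f (gauss n) s ^ 2 ≤ s ^ 2 * (7 * (b ^ 2 * M)) :=
      h1.trans (mul_le_mul_of_nonneg_left (by linarith) (sq_nonneg s))
    have h6 : s ^ 2 * (7 * (b ^ 2 * M)) = 7 * (S * M) := by rw [hS]; ring
    have h7 : L ≤ 3 := by
      have := Real.log_le_sub_one_of_pos hQ0
      linarith
    have h8 : 0 ≤ S * M := by positivity
    nlinarith

lemma measureReal_ge_le {n : ℕ} {f : (Fin n → ℝ) → ℝ} {a b A : ℝ} (ha : 0 < a)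
    (hb : 0 < b) (hA : 0 < A) (hfa : ∀ x y, |f x - f y| ≤ a * ‖x - y‖)
    (hfb : ∀ x y, |f x - f y| ≤ b * euclNorm (x - y))
    (hfA : ∀ i : Fin n, ∫ x, |pd i f x| ∂gauss n ≤ A) (hfi : Integrable f (gauss n))
    (hm : ∫ x, f x ∂gauss n = 0) {t : ℝ} (ht : 0 ≤ t) :
    (gauss n).real {x | t ≤ f x} ≤ 2 * Real.exp (-(1 / 32) * max (t ^ 2 / b ^ 2)
      (t / b * √(Real.log (Real.exp 1 + b ^ 2 / (a * A))))) := by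
  have hI := integrable_exp_mul_of_abs_sub_le ha.le hfa
  rcases le_total (t ^ 2 / b ^ 2)
    (t / b * √(Real.log (Real.exp 1 + b ^ 2 / (a * A)))) with hmax | hmax
  · rw [max_eq_right hmax]
    set L := Real.log (Real.exp 1 + b ^ 2 / (a * A)) with hL
    have hL0 : 0 < L := by
      refine Real.log_pos ?_
      have : 0 < b ^ 2 / (a * A) := by positivity
      linarith [Real.add_one_le_exp (1 : ℝ)]
    have hsL : 0 < √L := Real.sqrt_pos.2 hL0
    have hsL2 : √L ^ 2 = L := Real.sq_sqrt hL0.le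
    set r := √L / (16 * b) with hr
    have hr0 : 0 < r := by positivity
    have hr2 : 256 * b ^ 2 / L * r ^ 2 = 1 := by
      rw [hr, div_pow, hsL2]
      field_simp
      norm_num
    have hmgf : mgf f (gauss n) r ≤ Real.exp 1 := by
      refine (mgf_le_exp_of_mgf_two_mul_le ha.le hfa hfi hm
        (B := 2 * (256 * b ^ 2 / L)) (by positivity) hr0 fun x hx0 hx => ?_).trans_eq ?_
      · have h1 := mgf_sub_sq_le ha hb hA hfa hfb hfA hfi hm hx0
        rw [← hL] at h1
        set v := 256 * b ^ 2 / L * x ^ 2 with hv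
        have hv0 : 0 ≤ v := by positivity
        have hv1 : v ≤ 1 / 4 := by
          have h2 : x ^ 2 ≤ (r / 2) ^ 2 := pow_le_pow_left₀ hx0.le hx 2
          calc v ≤ 256 * b ^ 2 / L * (r / 2) ^ 2 := mul_le_mul_of_nonneg_left h2 (by positivity)
            _ = 256 * b ^ 2 / L * r ^ 2 / 4 := by ring
            _ = 1 / 4 := by rw [hr2]
        have h2 : 256 * x ^ 2 * b ^ 2 / L = v := by rw [hv]; ring
        have h3 : 2 * (256 * b ^ 2 / L) * x ^ 2 = 2 * v := by rw [hv]; ring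
        rw [h2] at h1
        rw [h3]
        have h4 := Real.add_one_le_exp (2 * v)
        have hM : 0 ≤ mgf f (gauss n) (2 * x) := mgf_nonneg
        have h5 : 1 ≤ Real.exp (2 * v) * (1 - v) := by nlinarith
        calc mgf f (gauss n) (2 * x) ≤ (Real.exp (2 * v) * (1 - v)) * mgf f (gauss n) (2 * x) :=
              le_mul_of_one_le_left hM h5
          _ = Real.exp (2 * v) * ((1 - v) * mgf f (gauss n) (2 * x)) := by ring
          _ ≤ _ := mul_le_mul_of_nonneg_left (by linarith) (Real.exp_pos _).le
      · congr 1
        linear_combination hr2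
    have h1 := measure_ge_le_exp_mul_mgf t hr0.le (hI r)
    have h2 : t / b * √L = 16 * (r * t) := by
      rw [hr]
      field_simp
    rw [h2]
    set x := r * t with hx
    have h3 : (gauss n).real {x | t ≤ f x} ≤ Real.exp (-x + 1) := by
      rw [Real.exp_add]
      refine h1.trans ?_
      rw [neg_mul, ← hx]
      exact mul_le_mul_of_nonneg_left hmgf (Real.exp_pos _).le
    have h4 : Real.exp (1 / 2) ≤ 2 := by
      have h5 : Real.exp (1 / 2) ^ 2 = Real.exp 1 := by
        rw [← Real.exp_nat_mul]
        norm_num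
      have := Real.exp_one_lt_three
      nlinarith [Real.exp_pos (1 / 2)]
    have h5 : Real.exp (1 / 2) * Real.exp (-(x / 2)) ≤
        2 * Real.exp (-(1 / 32) * (16 * x)) := by
      have : -(1 / 32) * (16 * x) = -(x / 2) := by ring
      rw [this]
      exact mul_le_mul_of_nonneg_right h4 (Real.exp_pos _).le
    refine le_trans ?_ h5
    rw [← Real.exp_add]
    rcases le_total x 1 with hx1 | hx1
    · exact measureReal_le_one.trans (Real.one_le_exp (by linarith))
    · exact h3.trans (Real.exp_le_exp.2 (by linarith))
  · rw [max_eq_left hmax]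
    have hs : 0 ≤ t / (8 * b ^ 2) := by positivity
    have h1 := measure_ge_le_exp_mul_mgf t hs (hI (t / (8 * b ^ 2)))
    have h2 := mgf_le_exp_sq ha.le hb.le hfa hfb hfi hm hs
    have h3 := mul_le_mul_of_nonneg_left h2 (Real.exp_pos (-(t / (8 * b ^ 2)) * t)).le
    rw [← Real.exp_add] at h3
    have h4 : -(t / (8 * b ^ 2)) * t + 4 * b ^ 2 * (t / (8 * b ^ 2)) ^ 2 =
        -(1 / 16) * (t ^ 2 / b ^ 2) := by
      field_simp
      ring
    rw [h4] at h3
    have h5 : Real.exp (-(1 / 16) * (t ^ 2 / b ^ 2)) ≤ Real.exp (-(1 / 32) * (t ^ 2 / b ^ 2)) :=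
      Real.exp_le_exp.2 (by
        have : 0 ≤ t ^ 2 / b ^ 2 := by positivity
        linarith)
    linarith [h1.trans h3, Real.exp_pos (-(1 / 32) * (t ^ 2 / b ^ 2))]

lemma integrable_of_abs_sub_le {n : ℕ} {f : (Fin n → ℝ) → ℝ} {a : ℝ} (ha : 0 ≤ a)
    (hf : ∀ x y, |f x - f y| ≤ a * ‖x - y‖) : Integrable f (gauss n) := by
  refine ((integrable_exp_mul_of_abs_sub_le ha hf 1).add
    (integrable_exp_mul_of_abs_sub_le ha hf (-1))).mono'
    (lipschitzWith_of_abs_sub_le hf).continuous.aestronglyMeasurable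
    (Filter.Eventually.of_forall fun x => ?_)
  have h1 := Real.add_one_le_exp (1 * f x)
  have h2 := Real.add_one_le_exp (-1 * f x)
  have h3 := Real.exp_pos (1 * f x)
  have h4 := Real.exp_pos (-1 * f x)
  rw [Real.norm_eq_abs]
  exact abs_le.2 ⟨by simp only [Pi.add_apply]; linarith, by simp only [Pi.add_apply]; linarith⟩

/-- Paouris–Valettas: sharpened variance and small-deviation bounds for Lipschitz
functions of a standard Gaussian vector. Here `‖x - y‖` is the sup norm on `ℝⁿ`. -/
theorem paouris_valettas :
    ∃ C c : ℝ, 0 < C ∧ 0 < c ∧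
      ∀ n : ℕ, ∀ f : (Fin n → ℝ) → ℝ, ∀ a b A : ℝ, 0 < a → 0 < b → 0 < A →
        (∀ x y, |f x - f y| ≤ b * euclNorm (x - y)) →
        (∀ x y, |f x - f y| ≤ a * ‖x - y‖) →
        (∀ i : Fin n, ∫ x, |pd i f x| ∂gauss n ≤ A) →
        (∀ lam : ℝ, 0 < lam →
          varG (fun x => Real.exp (lam * (f x - ∫ y, f y ∂gauss n))) ≤
            C * lam ^ 2 * b ^ 2 / Real.log (Real.exp 1 + b ^ 2 / (a * A)) *
              ∫ x, Real.exp (2 * lam * (f x - ∫ y, f y ∂gauss n)) ∂gauss n) ∧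
        (∀ t : ℝ, 0 ≤ t →
          (gauss n {x | t ≤ |f x - ∫ y, f y ∂gauss n|}).toReal ≤
            4 * Real.exp (-c * max (t ^ 2 / b ^ 2)
              (t / b * Real.sqrt (Real.log (Real.exp 1 + b ^ 2 / (a * A)))))) := by
  refine ⟨256, 1 / 32, by norm_num, by norm_num, fun n f a b A ha hb hA hfb hfa hfA => ?_⟩
  have hfi := integrable_of_abs_sub_le ha.le hfa
  set m := ∫ y, f y ∂gauss n with hm
  have hFa : ∀ x y, |(f x - m) - (f y - m)| ≤ a * ‖x - y‖ := fun x y => by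
    rw [sub_sub_sub_cancel_right]
    exact hfa x y
  have hFb : ∀ x y, |(f x - m) - (f y - m)| ≤ b * euclNorm (x - y) := fun x y => by
    rw [sub_sub_sub_cancel_right]
    exact hfb x y
  have hpd : ∀ i x, pd i (fun y => f y - m) x = pd i f x := fun i x => by
    rw [pd, fderiv_sub_const]
    rfl
  have hFA : ∀ i : Fin n, ∫ x, |pd i (fun y => f y - m) x| ∂gauss n ≤ A := fun i => by
    simp only [hpd]
    exact hfA i
  have hFi : Integrable (fun x => f x - m) (gauss n) := hfi.sub (integrable_const m)
  have hF0 : ∫ x, (f x - m) ∂gauss n = 0 := by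
    rw [integral_sub hfi (integrable_const m)]
    simp [hm]
  refine ⟨fun s hs => ?_, fun t ht => ?_⟩
  · rw [varG_exp_eq fun x => f x - m]
    exact mgf_sub_sq_le ha hb hA hFa hFb hFA hFi hF0 hs
  · have hNa : ∀ x y, |-(f x - m) - -(f y - m)| ≤ a * ‖x - y‖ := fun x y => by
      rw [neg_sub_neg, abs_sub_comm]
      exact hFa x y
    have hNb : ∀ x y, |-(f x - m) - -(f y - m)| ≤ b * euclNorm (x - y) := fun x y => by
      rw [neg_sub_neg, abs_sub_comm]
      exact hFb x y
    have hNA : ∀ i : Fin n, ∫ x, |pd i (fun y => -(f y - m)) x| ∂gauss n ≤ A := fun i => by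
      have h1 : ∀ x, |pd i (fun y => -(f y - m)) x| = |pd i (fun y => f y - m) x| := fun x => by
        rw [pd, fderiv_fun_neg, neg_apply, abs_neg]
        rfl
      simp only [h1]
      exact hFA i
    have hN0 : ∫ x, -(f x - m) ∂gauss n = 0 := by rw [integral_neg, hF0, neg_zero]
    have h1 := measureReal_ge_le ha hb hA hFa hFb hFA hFi hF0 ht
    have h2 := measureReal_ge_le ha hb hA hNa hNb hNA hFi.neg hN0 ht
    have h3 : {x | t ≤ |f x - m|} = {x | t ≤ f x - m} ∪ {x | t ≤ -(f x - m)} := by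
      ext x
      simp only [Set.mem_ofPred_eq, Set.mem_union, le_abs]
    rw [h3]
    have h4 := measureReal_union_le (μ := gauss n) {x | t ≤ f x - m} {x | t ≤ -(f x - m)}
    rw [Measure.real] at h4
    linarith
end
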